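/- arXiv:0707.0734 — 2 statements merged into one kernel-verified Lean document; each statement's English description precedes it below -/
import Mathlib

section
/- Assume the chain is transient, i.e. D(0,∞) < ∞, and that p_R → 0 as R → ∞. Then for every M > 0, with probability 1, ξ(R,∞) ≥ M D(R,∞) for infinitely many R. -/
open MeasureTheory Filter Finset
open scoped ENNReal NNReal Topology

noncomputable section

namespace NNRW

/-- Probability of a step to the right from site `i`: `E 0 = 1`, `E i = 1/2 + p i` for `i ≥ 1`. -/
def E (p : ℕ → ℝ) (i : ℕ) : ℝ := if i = 0 then 1 else 1 / 2 + p i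

/-- One-step transition probability of the nearest-neighbour walk, from `i` to `j`. -/
def step (p : ℕ → ℝ) (i j : ℕ) : ℝ :=
  if j = i + 1 then E p i else if j + 1 = i then 1 - E p i else 0

/-- `X` is (distributed as) the nearest-neighbour Markov chain with parameters `p`, started
at `b`, under the probability measure `P`: `X 0 = b` and the finite-dimensional
distributions are the products of the one-step transition probabilities. -/
def IsNNWalk {Ω : Type*} [MeasurableSpace Ω] (P : Measure Ω)
    (X : ℕ → Ω → ℕ) (p : ℕ → ℝ) (b : ℕ) : Prop :=
  (∀ ω, X 0 ω = b) ∧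
    ∀ (n : ℕ) (u : ℕ → ℕ), u 0 = b →
      P {ω | ∀ k ≤ n, X k ω = u k} =
        ENNReal.ofReal (∏ k ∈ Finset.range n, step p (u k) (u (k + 1)))

/-- `U i = (1/2 - p i)/(1/2 + p i)`. -/
def U (p : ℕ → ℝ) (i : ℕ) : ℝ := (1 / 2 - p i) / (1 / 2 + p i)

/-- `D(m,n)` for finite `m ≤ n`. -/
def Dfin (p : ℕ → ℝ) (m n : ℕ) : ℝ :=
  if n = m then 0
  else 1 + ∑ j ∈ Finset.Icc 1 (n - m - 1), ∏ i ∈ Finset.Icc 1 j, U p (m + i)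

/-- `D(m,∞) = lim_{n → ∞} D(m,n) ∈ (0,∞]`. -/
def Dinf (p : ℕ → ℝ) (m : ℕ) : ℝ≥0∞ :=
  1 + ∑' j : ℕ, ENNReal.ofReal (∏ i ∈ Finset.Icc 1 (j + 1), U p (m + i))

/-- Event: the walk visits `a` (strictly) before it ever visits `c`. -/
def hitsBefore {Ω : Type*} (X : ℕ → Ω → ℕ) (a c : ℕ) : Set Ω :=
  {ω | ∃ n, X n ω = a ∧ ∀ k < n, X k ω ≠ c}

/-- Event: the walk ever visits `a`. -/
def hits {Ω : Type*} (X : ℕ → Ω → ℕ) (a : ℕ) : Set Ω := {ω | ∃ n, X n ω = a}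

/-- Total local time `ξ(x,∞)` at site `x` (equal to `∞` if there are infinitely many
visits). -/
def localTime {Ω : Type*} (X : ℕ → Ω → ℕ) (x : ℕ) (ω : Ω) : ℝ≥0∞ :=
  ∑' k : ℕ, Set.indicator {k | X k ω = x} (fun _ => (1 : ℝ≥0∞)) k

/-- Total number of upcrossings `ξ(x,∞,↑)` at site `x`. -/
def upcross {Ω : Type*} (X : ℕ → Ω → ℕ) (x : ℕ) (ω : Ω) : ℝ≥0∞ :=
  ∑' k : ℕ, Set.indicator {k | X k ω = x ∧ X (k + 1) ω = x + 1} (fun _ => (1 : ℝ≥0∞)) k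

/-- Iterated logarithm: `iterLog 0 x = x`, `iterLog (k+1) x = log (iterLog k x)`. -/
def iterLog : ℕ → ℝ → ℝ
  | 0, x => x
  | k + 1, x => Real.log (iterLog k x)

/-- `λ(k,x)`: `lam 0 x = 1`, `lam (k+1) x = lam k x * log_k x`. -/
def lam : ℕ → ℝ → ℝ
  | 0, _ => 1
  | k + 1, x => lam k x * iterLog k x

/-- `Λ(K,x,B) = Λ(K-1,x) + B/λ(K,x)` where `Λ(K,x) = ∑_{k=1}^{K} 1/λ(k,x)`. -/
def LamB (K : ℕ) (B : ℝ) (x : ℝ) : ℝ :=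
  (∑ k ∈ Finset.Icc 1 (K - 1), 1 / lam k x) + B / lam K x

/-- The truncation convention: with `i₀ = min{i ≥ 1 : q i < 1/2}` one has `p i = q i₀`
for `1 ≤ i ≤ i₀` and `p i = q i` for `i > i₀`. -/
def IsTruncation (q p : ℕ → ℝ) : Prop :=
  ∃ i0 : ℕ, 1 ≤ i0 ∧ q i0 < 1 / 2 ∧ (∀ i, 1 ≤ i → i < i0 → ¬ q i < 1 / 2) ∧
    (∀ i, 1 ≤ i → i ≤ i0 → p i = q i0) ∧ ∀ i, i0 < i → p i = q i

end NNRW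

namespace NNRW

/-- Paths agreeing with `u` up to time `n`. -/
def cyl (n : ℕ) (u : ℕ → ℕ) : Set (ℕ → ℕ) := {x | ∀ k ≤ n, x k = u k}

/-- Number of visits of the path `x` to `R` from time `n` on. -/
def visitsFrom (R n : ℕ) (x : ℕ → ℕ) : ℝ≥0∞ :=
  ∑' k : ℕ, Set.indicator {k | x (n + k) = R} (fun _ => (1 : ℝ≥0∞)) k

lemma visitsFrom_succ (R n : ℕ) (x : ℕ → ℕ) :
    visitsFrom R n x = (if x n = R then 1 else 0) + visitsFrom R (n + 1) x := by
  unfold visitsFrom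
  rw [tsum_eq_zero_add' ENNReal.summable]
  congr 1
  · simp [Set.indicator_apply]
  · refine tsum_congr fun k => ?_
    simp [Set.indicator_apply, add_assoc, add_comm 1 k]

lemma visitsFrom_le_zero (R n : ℕ) (x : ℕ → ℕ) : visitsFrom R n x ≤ visitsFrom R 0 x := by
  induction n with
  | zero => rfl
  | succ n ih =>
    refine le_trans ?_ ih
    rw [visitsFrom_succ R n x]
    exact le_add_self

lemma visitsFrom_zero (R : ℕ) (x : ℕ → ℕ) :
    visitsFrom R 0 x = localTime (fun k (y : ℕ → ℕ) => y k) R x := by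
  simp [visitsFrom, localTime]

lemma measurable_visitsFrom (R n : ℕ) : Measurable (visitsFrom R n) := by
  unfold visitsFrom
  refine Measurable.tsum fun k => ?_
  have : (fun x : ℕ → ℕ => Set.indicator {k | x (n + k) = R} (fun _ => (1 : ℝ≥0∞)) k) =
      Set.indicator ((fun x : ℕ → ℕ => x (n + k)) ⁻¹' {R}) (fun _ => 1) := by
    ext x
    by_cases hx : x (n + k) = R <;> simp [Set.indicator, hx]
  rw [this]
  exact measurable_const.indicator (measurable_pi_apply _ (measurableSet_singleton _))

lemma measurableSet_cyl (n : ℕ) (u : ℕ → ℕ) : MeasurableSet (cyl n u) := by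
  have : cyl n u = ⋂ k ∈ Set.Iic n, (fun x : ℕ → ℕ => x k) ⁻¹' {u k} := by
    ext x
    simp [cyl]
  rw [this]
  exact MeasurableSet.biInter (Set.to_countable _)
    fun k _ => measurable_pi_apply _ (measurableSet_singleton _)

lemma mem_cyl_succ_update {n y : ℕ} {u x : ℕ → ℕ} :
    x ∈ cyl (n + 1) (Function.update u (n + 1) y) ↔ x ∈ cyl n u ∧ x (n + 1) = y := by
  simp only [cyl, Set.mem_ofPred_eq]
  constructor
  · intro h
    refine ⟨fun k hk => ?_, by simpa using h (n + 1) le_rfl⟩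
    have := h k (by omega)
    rwa [Function.update_of_ne (by omega)] at this
  · rintro ⟨h, rfl⟩ k hk
    rcases eq_or_lt_of_le hk with rfl | hk
    · simp
    · rw [Function.update_of_ne (by omega)]
      exact h k (by omega)

lemma prod_step_update (p : ℕ → ℝ) (n y : ℕ) (u : ℕ → ℕ) :
    ∏ k ∈ range (n + 1), step p (Function.update u (n + 1) y k)
        (Function.update u (n + 1) y (k + 1)) =
      (∏ k ∈ range n, step p (u k) (u (k + 1))) * step p (u n) y := by
  rw [prod_range_succ]
  congr 1
  · refine prod_congr rfl fun k hk => ?_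
    have := mem_range.1 hk
    rw [Function.update_of_ne (by omega), Function.update_of_ne (by omega)]
  · rw [Function.update_of_ne (by omega), Function.update_self]

lemma half_le_E {p : ℕ → ℝ} (hp : ∀ i, 1 ≤ i → 0 ≤ p i ∧ p i < 1 / 2) (i : ℕ) :
    1 / 2 ≤ E p i := by
  unfold E
  split_ifs with h
  · norm_num
  · linarith [hp i (by omega)]

lemma E_le_one {p : ℕ → ℝ} (hp : ∀ i, 1 ≤ i → 0 ≤ p i ∧ p i < 1 / 2) (i : ℕ) :
    E p i ≤ 1 := by
  unfold E
  split_ifs with h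
  · norm_num
  · linarith [hp i (by omega)]

lemma step_up (p : ℕ → ℝ) (i : ℕ) : step p i (i + 1) = E p i := by simp [step]

lemma step_down (p : ℕ → ℝ) (i : ℕ) : step p i (i - 1) = 1 - E p i := by
  rcases i with _ | i
  · simp [step, E]
  · rw [Nat.add_sub_cancel, step, if_neg (by omega), if_pos rfl]

lemma step_nonneg {p : ℕ → ℝ} (hp : ∀ i, 1 ≤ i → 0 ≤ p i ∧ p i < 1 / 2) (i j : ℕ) :
    0 ≤ step p i j := by
  unfold step
  split_ifs
  · linarith [half_le_E hp i]
  · linarith [E_le_one hp i]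
  · rfl

lemma U_pos {p : ℕ → ℝ} (hp : ∀ i, 1 ≤ i → 0 ≤ p i ∧ p i < 1 / 2) {i : ℕ} (hi : 1 ≤ i) :
    0 < U p i := by
  have := hp i hi
  exact div_pos (by linarith) (by linarith)

lemma E_mul_U {p : ℕ → ℝ} (hp : ∀ i, 1 ≤ i → 0 ≤ p i ∧ p i < 1 / 2) {i : ℕ} (hi : 1 ≤ i) :
    E p i * U p i = 1 - E p i := by
  have := hp i hi
  have h : (1 / 2 + p i) ≠ 0 := by linarith
  rw [E, if_neg (by omega), U, mul_div_cancel₀ _ h]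
  ring

/-- The product `∏_{i=1}^{j} U (R + i)`. -/
def prodU (p : ℕ → ℝ) (R j : ℕ) : ℝ := ∏ i ∈ range j, U p (R + (i + 1))

/-- The partial sums of `D(R,∞)`. -/
def partialD (p : ℕ → ℝ) (R k : ℕ) : ℝ := ∑ j ∈ range k, prodU p R j

lemma prodU_pos {p : ℕ → ℝ} (hp : ∀ i, 1 ≤ i → 0 ≤ p i ∧ p i < 1 / 2) (R j : ℕ) :
    0 < prodU p R j := prod_pos fun i _ => U_pos hp (by omega)

lemma one_le_partialD {p : ℕ → ℝ} (hp : ∀ i, 1 ≤ i → 0 ≤ p i ∧ p i < 1 / 2) (R : ℕ) {k : ℕ}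
    (hk : 1 ≤ k) : 1 ≤ partialD p R k := by
  have h : prodU p R 0 ≤ partialD p R k :=
    single_le_sum (f := prodU p R) (fun j _ => (prodU_pos hp R j).le) (mem_range.2 hk)
  simpa [prodU] using h

lemma Dinf_eq_tsum (p : ℕ → ℝ) (R : ℕ) :
    Dinf p R = ∑' j, ENNReal.ofReal (prodU p R j) := by
  rw [tsum_eq_zero_add' ENNReal.summable, Dinf]
  congr 1
  · simp [prodU]
  · refine tsum_congr fun j => ?_
    rw [prodU, ← Nat.Ico_zero_eq_range, prod_Ico_add' (fun i => U p (R + i)) 0 (j + 1) 1]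
    rfl

lemma Dinf_lt_top {p : ℕ → ℝ} (hp : ∀ i, 1 ≤ i → 0 ≤ p i ∧ p i < 1 / 2)
    (htrans : Dinf p 0 < ⊤) (R : ℕ) : Dinf p R < ⊤ := by
  have h : ENNReal.ofReal (prodU p 0 R) * Dinf p R ≤ Dinf p 0 := by
    rw [Dinf_eq_tsum, Dinf_eq_tsum, ← ENNReal.tsum_mul_left]
    calc ∑' j, ENNReal.ofReal (prodU p 0 R) * ENNReal.ofReal (prodU p R j)
        = ∑' j, ENNReal.ofReal (prodU p 0 (R + j)) := by
          refine tsum_congr fun j => ?_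
          rw [← ENNReal.ofReal_mul (prodU_pos hp 0 R).le]
          congr 1
          simp [prodU, prod_range_add, add_assoc]
      _ ≤ _ := ENNReal.tsum_comp_le_tsum_of_injective (add_right_injective R) _
  refine lt_top_iff_ne_top.2 fun htop => ?_
  rw [htop, ENNReal.mul_top (by simpa using prodU_pos hp 0 R)] at h
  exact absurd htrans (not_lt.2 h)

lemma exists_le_two_mul_partialD {p : ℕ → ℝ} (hp : ∀ i, 1 ≤ i → 0 ≤ p i ∧ p i < 1 / 2)
    (htrans : Dinf p 0 < ⊤) (R : ℕ) :
    ∃ k, 1 ≤ k ∧ (Dinf p R).toReal ≤ 2 * partialD p R k := by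
  have hfin := Dinf_lt_top hp htrans R
  have hs : HasSum (prodU p R) (Dinf p R).toReal := by
    rw [Dinf_eq_tsum] at hfin ⊢
    convert ENNReal.hasSum_toReal hfin.ne with j
    · exact (ENNReal.toReal_ofReal (prodU_pos hp R j).le).symm
    · exact ENNReal.tsum_toReal_eq fun j => ENNReal.ofReal_ne_top
  have hpos : 0 < (Dinf p R).toReal :=
    hs.tsum_eq ▸ hs.summable.tsum_pos (fun j => (prodU_pos hp R j).le) 0 (prodU_pos hp R 0)
  have := (hs.tendsto_sum_nat.eventually (lt_mem_nhds (half_lt_self hpos))).and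
    (eventually_ge_atTop 1)
  obtain ⟨k, hk, hk1⟩ := this.exists
  exact ⟨k, hk1, by unfold partialD; linarith⟩

/-- Probability that the walk started at `x ≤ R + k` hits `R` before `R + k`. -/
def hitProb (p : ℕ → ℝ) (R k x : ℕ) : ℝ := 1 - partialD p R (x - R) / partialD p R k

lemma hitProb_le_one {p : ℕ → ℝ} (hp : ∀ i, 1 ≤ i → 0 ≤ p i ∧ p i < 1 / 2) (R k x : ℕ) :
    hitProb p R k x ≤ 1 := by
  have h (j : ℕ) : 0 ≤ partialD p R j := sum_nonneg fun i _ => (prodU_pos hp R i).le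
  have := div_nonneg (h (x - R)) (h k)
  unfold hitProb
  linarith

lemma hitProb_of_le {p : ℕ → ℝ} {R k x : ℕ} (h : x ≤ R) : hitProb p R k x = 1 := by
  simp [hitProb, Nat.sub_eq_zero_of_le h, partialD]

lemma hitProb_add {p : ℕ → ℝ} (hp : ∀ i, 1 ≤ i → 0 ≤ p i ∧ p i < 1 / 2) {R k : ℕ}
    (hk : 1 ≤ k) : hitProb p R k (R + k) = 0 := by
  have := one_le_partialD hp R hk
  rw [hitProb, Nat.add_sub_cancel_left, div_self (by linarith), sub_self]

lemma hitProb_average {p : ℕ → ℝ} (hp : ∀ i, 1 ≤ i → 0 ≤ p i ∧ p i < 1 / 2) {R k : ℕ} (x : ℕ) :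
    E p x * hitProb p R k (x + 1) + (1 - E p x) * hitProb p R k (x - 1) =
      if x = R then 1 - E p R / partialD p R k else hitProb p R k x := by
  rcases lt_trichotomy x R with h | rfl | h
  · rw [if_neg h.ne, hitProb_of_le h.le, hitProb_of_le (by omega), hitProb_of_le (by omega)]
    ring
  · rw [if_pos rfl, hitProb_of_le (Nat.sub_le _ _), hitProb, Nat.add_sub_cancel_left]
    simp only [partialD, sum_range_one, prodU, range_zero, prod_empty]
    ring
  · rw [if_neg h.ne']
    obtain ⟨m, rfl⟩ := Nat.exists_eq_add_of_lt h
    have e1 : R + m + 1 + 1 - R = m + 1 + 1 := by omega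
    have e2 : R + m + 1 - 1 - R = m := by omega
    have e3 : R + m + 1 - R = m + 1 := by omega
    have hd1 : partialD p R (m + 1) = partialD p R m + prodU p R m := sum_range_succ _ _
    have hd2 : partialD p R (m + 1 + 1) = partialD p R (m + 1) + prodU p R (m + 1) :=
      sum_range_succ _ _
    have hd3 : prodU p R (m + 1) = prodU p R m * U p (R + m + 1) := prod_range_succ _ _
    have hU := E_mul_U hp (i := R + m + 1) (by omega)
    simp only [hitProb, e1, e2, e3]
    rw [hd2, hd3, hd1]
    linear_combination (-(prodU p R m / partialD p R k)) * hU

/-- An upper bound for the expected exit time of the walk from `[0, N)`. -/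
lemma exitTime_average {p : ℕ → ℝ} (hp : ∀ i, 1 ≤ i → 0 ≤ p i ∧ p i < 1 / 2) (N x : ℕ) :
    E p x * ((N : ℝ) ^ 2 - ((x + 1 : ℕ) : ℝ) ^ 2) +
        (1 - E p x) * ((N : ℝ) ^ 2 - ((x - 1 : ℕ) : ℝ) ^ 2) ≤ (N : ℝ) ^ 2 - (x : ℝ) ^ 2 - 1 := by
  rcases x with _ | x
  · simp [E]
  · have := half_le_E hp (x + 1)
    have hx : (0 : ℝ) ≤ x := x.cast_nonneg
    push_cast [Nat.add_sub_cancel]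
    nlinarith

/-- `μ` is the law on path space of a nearest-neighbour walk, described through the
conditional probabilities of cylinders. -/
structure IsWalkLaw (p : ℕ → ℝ) (μ : Measure (ℕ → ℕ)) : Prop where
  extend : ∀ n u y, μ.real (cyl (n + 1) (Function.update u (n + 1) y)) =
    μ.real (cyl n u) * step p (u n) y

lemma measureReal_cyl_inter_visits_ge_approx {p : ℕ → ℝ}
    (hp : ∀ i, 1 ≤ i → 0 ≤ p i ∧ p i < 1 / 2)
    {μ : Measure (ℕ → ℕ)} [IsProbabilityMeasure μ] (hμ : IsWalkLaw p μ) {R N : ℕ} (hN : 1 ≤ N)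
    (m j n : ℕ) (u : ℕ → ℕ) (hu : u n ≤ R + N) :
    μ.real (cyl n u) * (hitProb p R N (u n) * (1 - E p R / partialD p R N) ^ j -
        (((R + N : ℕ) : ℝ) ^ 2 - (u n : ℝ) ^ 2) / (m + 1)) ≤
      μ.real (cyl n u ∩ {x | (j : ℝ≥0∞) ≤ visitsFrom R n x}) := by
  set r := 1 - E p R / partialD p R N with hr
  have hD := one_le_partialD hp R hN
  have hq : E p R / partialD p R N ≤ 1 :=
    (div_le_one (by linarith)).2 ((E_le_one hp R).trans hD)
  have hq0 : 0 ≤ E p R / partialD p R N := div_nonneg (by linarith [half_le_E hp R]) (by linarith)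
  have hr0 : 0 ≤ r := by linarith
  have hr1 : r ≤ 1 := by linarith
  have hF (x i : ℕ) : hitProb p R N x * r ^ i ≤ 1 := by
    have h1 := mul_le_mul_of_nonneg_right (hitProb_le_one hp R N x) (pow_nonneg hr0 i)
    have h2 : r ^ i ≤ 1 := pow_le_one₀ hr0 hr1
    linarith
  have trivial_bound {n : ℕ} {u : ℕ → ℕ} {b : ℝ} (S : Set (ℕ → ℕ)) (hb : b ≤ 0) :
      μ.real (cyl n u) * b ≤ μ.real S :=
    (mul_nonpos_of_nonneg_of_nonpos measureReal_nonneg hb).trans measureReal_nonneg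
  have hT {x : ℕ} (hx : x ≤ R + N) : 0 ≤ ((R + N : ℕ) : ℝ) ^ 2 - (x : ℝ) ^ 2 := by
    have : (x : ℝ) ≤ (R + N : ℕ) := by exact_mod_cast hx
    nlinarith [(x.cast_nonneg : (0 : ℝ) ≤ x)]
  induction m generalizing j n u with
  | zero =>
    rcases eq_or_lt_of_le hu with h | h
    · rw [h, hitProb_add hp hN]
      exact trivial_bound _ (by simp)
    · refine trivial_bound _ ?_
      have h1 : (u n : ℝ) + 1 ≤ (R + N : ℕ) := by exact_mod_cast h
      have h2 := hF (u n) j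
      have h3 : (0 : ℝ) ≤ u n := Nat.cast_nonneg _
      simp only [Nat.cast_zero, zero_add, div_one]
      nlinarith
  | succ m ih =>
    rcases eq_or_lt_of_le hu with h | h
    · rw [h, hitProb_add hp hN]
      exact trivial_bound _ (by simp)
    have hm : (0 : ℝ) < m + 1 := by positivity
    have hT0 := hT hu
    rcases j with _ | j
    · have : cyl n u ∩ {x | ((0 : ℕ) : ℝ≥0∞) ≤ visitsFrom R n x} = cyl n u := by simp
      rw [this]
      refine mul_le_of_le_one_right measureReal_nonneg ?_
      have : 0 ≤ (((R + N : ℕ) : ℝ) ^ 2 - (u n : ℝ) ^ 2) / (((m + 1 : ℕ) : ℝ) + 1) := by positivity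
      linarith [hF (u n) 0]
    by_cases hbig : (m : ℝ) + 2 < ((R + N : ℕ) : ℝ) ^ 2 - (u n : ℝ) ^ 2
    · refine trivial_bound _ ?_
      have : 1 ≤ (((R + N : ℕ) : ℝ) ^ 2 - (u n : ℝ) ^ 2) / (((m + 1 : ℕ) : ℝ) + 1) := by
        rw [le_div_iff₀ (by positivity)]
        push_cast at hbig ⊢
        linarith
      linarith [hF (u n) (j + 1)]
    set i := if u n = R then j else j + 1 with hi
    set G : Set (ℕ → ℕ) := {x | (i : ℝ≥0∞) ≤ visitsFrom R (n + 1) x} with hG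
    have hsub (y : ℕ) : cyl (n + 1) (Function.update u (n + 1) y) ∩ G ⊆
        cyl n u ∩ {x | ((j + 1 : ℕ) : ℝ≥0∞) ≤ visitsFrom R n x} := by
      rintro x ⟨hx, hxG⟩
      have hx' := (mem_cyl_succ_update.1 hx).1
      refine ⟨hx', ?_⟩
      simp only [hG, hi, Set.mem_ofPred_eq] at hxG ⊢
      rw [visitsFrom_succ, hx' n le_rfl]
      split_ifs at hxG ⊢ with hR
      · push_cast
        rw [add_comm]
        gcongr
      · simpa using hxG
    have hdisj : Disjoint (cyl (n + 1) (Function.update u (n + 1) (u n + 1)) ∩ G)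
        (cyl (n + 1) (Function.update u (n + 1) (u n - 1)) ∩ G) := by
      refine Set.disjoint_left.2 fun x h1 h2 => ?_
      have h1 := (mem_cyl_succ_update.1 h1.1).2
      have h2 := (mem_cyl_succ_update.1 h2.1).2
      omega
    have hmeas : MeasurableSet (cyl (n + 1) (Function.update u (n + 1) (u n - 1)) ∩ G) :=
      (measurableSet_cyl _ _).inter (measurableSet_le measurable_const (measurable_visitsFrom _ _))
    have hle := measureReal_mono (μ := μ) (Set.union_subset (hsub (u n + 1)) (hsub (u n - 1)))
    rw [measureReal_union hdisj hmeas] at hle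
    have h1 := ih i (n + 1) (Function.update u (n + 1) (u n + 1)) (by simpa using h)
    have h2 := ih i (n + 1) (Function.update u (n + 1) (u n - 1)) (by rw [Function.update_self]; omega)
    rw [hμ.extend, Function.update_self, step_up] at h1
    rw [hμ.extend, Function.update_self, step_down] at h2
    refine le_trans ?_ ((add_le_add h1 h2).trans hle)
    have hav : E p (u n) * (hitProb p R N (u n + 1) * r ^ i) +
        (1 - E p (u n)) * (hitProb p R N (u n - 1) * r ^ i) = hitProb p R N (u n) * r ^ (j + 1) := by
      have := hitProb_average hp (R := R) (k := N) (u n)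
      by_cases hR : u n = R
      · rw [if_pos hR, ← hr] at this
        rw [hi, if_pos hR, hitProb_of_le hR.le]
        linear_combination (r ^ j) * this
      · rw [if_neg hR] at this
        rw [hi, if_neg hR]
        linear_combination (r ^ (j + 1)) * this
    have hex := div_le_div_of_nonneg_right (exitTime_average hp (R + N) (u n)) hm.le
    have hfrac : (((R + N : ℕ) : ℝ) ^ 2 - (u n : ℝ) ^ 2 - 1) / ((m : ℝ) + 1) ≤
        (((R + N : ℕ) : ℝ) ^ 2 - (u n : ℝ) ^ 2) / (((m + 1 : ℕ) : ℝ) + 1) := by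
      rw [div_le_div_iff₀ hm (by positivity)]
      push_cast at hbig ⊢
      nlinarith
    rw [add_div, mul_div_assoc, mul_div_assoc] at hex
    have := mul_le_mul_of_nonneg_left (hex.trans hfrac) (measureReal_nonneg (μ := μ) (s := cyl n u))
    rw [← hav]
    linarith

lemma measureReal_cyl_inter_visits_ge {p : ℕ → ℝ} (hp : ∀ i, 1 ≤ i → 0 ≤ p i ∧ p i < 1 / 2)
    {μ : Measure (ℕ → ℕ)} [IsProbabilityMeasure μ] (hμ : IsWalkLaw p μ) {R N : ℕ} (hN : 1 ≤ N)
    (j n : ℕ) (u : ℕ → ℕ) (hu : u n ≤ R) :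
    μ.real (cyl n u) * (1 - E p R / partialD p R N) ^ j ≤
      μ.real (cyl n u ∩ {x | (j : ℝ≥0∞) ≤ visitsFrom R 0 x}) := by
  have hlim : Tendsto (fun m : ℕ => μ.real (cyl n u) *
      (hitProb p R N (u n) * (1 - E p R / partialD p R N) ^ j -
        (((R + N : ℕ) : ℝ) ^ 2 - (u n : ℝ) ^ 2) / ((m : ℝ) + 1))) atTop
      (𝓝 (μ.real (cyl n u) * (hitProb p R N (u n) * (1 - E p R / partialD p R N) ^ j - 0))) := by
    refine ((tendsto_const_nhds (x := hitProb p R N (u n) *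
      (1 - E p R / partialD p R N) ^ j)).sub ?_).const_mul _
    exact tendsto_const_nhds.div_atTop
      (tendsto_atTop_add_const_right _ _ tendsto_natCast_atTop_atTop)
  rw [hitProb_of_le hu, sub_zero, one_mul] at hlim
  refine (le_of_tendsto' hlim fun m => ?_).trans (measureReal_mono (Set.inter_subset_inter_right _
    fun x hx => le_trans hx (visitsFrom_le_zero R n x)))
  have := measureReal_cyl_inter_visits_ge_approx hp hμ (R := R) hN m j n u (by omega)
  rwa [hitProb_of_le hu, one_mul] at this

/-- Uniform lower bound for the conditional probability of a large local time at a far site. -/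
lemma eventually_measureReal_cyl_inter_ge {p : ℕ → ℝ}
    (hp : ∀ i, 1 ≤ i → 0 ≤ p i ∧ p i < 1 / 2) (htrans : Dinf p 0 < ⊤)
    (hplim : Tendsto p atTop (𝓝 0))
    {μ : Measure (ℕ → ℕ)} [IsProbabilityMeasure μ] (hμ : IsWalkLaw p μ) {M : ℝ} (hM : 0 < M)
    (n : ℕ) (u : ℕ → ℕ) :
    ∀ᶠ R in atTop, μ.real (cyl n u) * Real.exp (-(4 * (2 * M + 1))) ≤
      μ.real (cyl n u ∩ {x | ENNReal.ofReal M * Dinf p R ≤ visitsFrom R 0 x}) := by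
  filter_upwards [eventually_ge_atTop (u n), eventually_ge_atTop 1,
    hplim.eventually (gt_mem_nhds (show (0 : ℝ) < 1 / 4 by norm_num))] with R hR hR1 hpR
  obtain ⟨N, hN, hD⟩ := exists_le_two_mul_partialD hp htrans R
  set D := (Dinf p R).toReal with hDdef
  have hDeq : ENNReal.ofReal M * Dinf p R = ENNReal.ofReal (M * D) := by
    rw [ENNReal.ofReal_mul hM.le, hDdef, ENNReal.ofReal_toReal (Dinf_lt_top hp htrans R).ne]
  have hD0 : 0 ≤ D := ENNReal.toReal_nonneg
  have hd := one_le_partialD hp R hN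
  set d := partialD p R N
  set q := E p R / d with hq
  have hE : E p R ≤ 3 / 4 := by
    rw [E, if_neg (by omega)]
    linarith
  have hE0 := half_le_E hp R
  have hq0 : 0 ≤ q := div_nonneg (by linarith) (by linarith)
  have hqd : q * d = E p R := div_mul_cancel₀ _ (by linarith)
  have hq1 : q ≤ 3 / 4 := by nlinarith
  have hexp : Real.exp (-(4 * q)) ≤ 1 - q := by
    rw [Real.exp_neg, inv_le_comm₀ (Real.exp_pos _) (by linarith)]
    refine le_trans ?_ (Real.add_one_le_exp _)
    rw [inv_le_iff_one_le_mul₀ (by linarith)]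
    nlinarith
  set j := ⌈M * D⌉₊
  have hj : (j : ℝ) < M * D + 1 := Nat.ceil_lt_add_one (by positivity)
  have hpow : Real.exp (-(4 * (2 * M + 1))) ≤ (1 - q) ^ j := by
    refine le_trans ?_ (pow_le_pow_left₀ (Real.exp_pos _).le hexp j)
    rw [← Real.exp_nat_mul, Real.exp_le_exp]
    have h1 : q * j ≤ q * (M * D + 1) := mul_le_mul_of_nonneg_left hj.le hq0
    have h2 : q * D ≤ 2 := by nlinarith
    nlinarith
  refine (mul_le_mul_of_nonneg_left hpow measureReal_nonneg).trans
    ((measureReal_cyl_inter_visits_ge hp hμ hN j n u hR).trans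
      (measureReal_mono (Set.inter_subset_inter_right _ fun x hx => ?_)))
  rw [Set.mem_ofPred_eq, hDeq]
  refine le_trans ?_ hx
  rw [← ENNReal.ofReal_natCast]
  exact ENNReal.ofReal_le_ofReal (Nat.le_ceil _)

lemma setOf_frequently_eq (A : ℕ → Set (ℕ → ℕ)) :
    {x | ∃ᶠ R in atTop, x ∈ A R} = ⋂ n : ℕ, ⋃ R ≥ n, A R := by
  ext x
  simp [frequently_atTop]

lemma mul_measureReal_le_inter_frequently {μ : Measure (ℕ → ℕ)} [IsProbabilityMeasure μ]
    {A : ℕ → Set (ℕ → ℕ)} (hA : ∀ R, MeasurableSet (A R)) {c : ℝ} {S : Set (ℕ → ℕ)}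
    (hS : MeasurableSet S) (h : ∀ᶠ R in atTop, μ.real S * c ≤ μ.real (S ∩ A R)) :
    μ.real S * c ≤ μ.real (S ∩ {x | ∃ᶠ R in atTop, x ∈ A R}) := by
  have hanti : Antitone fun n : ℕ => S ∩ ⋃ R ≥ n, A R := fun a b hab =>
    Set.inter_subset_inter_right _
      (Set.biUnion_subset_biUnion_left fun R (hR : b ≤ R) => hab.trans hR)
  have hlim := tendsto_measure_iInter_atTop (μ := μ) (s := fun n : ℕ => S ∩ ⋃ R ≥ n, A R)
    (fun n => (hS.inter (.biUnion (Set.to_countable _) fun R _ => hA R)).nullMeasurableSet)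
    hanti ⟨0, measure_ne_top _ _⟩
  rw [← Set.inter_iInter, ← setOf_frequently_eq] at hlim
  refine ge_of_tendsto ((ENNReal.tendsto_toReal (measure_ne_top _ _)).comp hlim) ?_
  filter_upwards [h] with R hR
  exact hR.trans (measureReal_mono (Set.inter_subset_inter_right _
    (Set.subset_biUnion_of_mem (u := A) (show R ≥ R from le_rfl))))

/-- Extension of a finite path by `0`. -/
def extendPath {n : ℕ} (t : Fin (n + 1) → ℕ) (k : ℕ) : ℕ :=
  if hk : k < n + 1 then t ⟨k, hk⟩ else 0

lemma mem_cyl_extendPath {n : ℕ} {t : Fin (n + 1) → ℕ} {x : ℕ → ℕ} :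
    x ∈ cyl n (extendPath t) ↔ (fun i : Fin (n + 1) => x i) = t := by
  constructor
  · intro h
    ext i
    have := h i (Nat.le_of_lt_succ i.2)
    rwa [extendPath, dif_pos i.2] at this
  · rintro rfl k hk
    rw [extendPath, dif_pos (Nat.lt_succ_of_le hk)]

/-- A zero-one law: an event whose conditional probability given any initial segment of the path
is bounded below has full measure. -/
lemma ae_mem_of_cyl_le {μ : Measure (ℕ → ℕ)} [IsProbabilityMeasure μ] {L : Set (ℕ → ℕ)}
    (hL : MeasurableSet L) {c : ℝ} (hc : 0 < c)
    (h : ∀ n u, μ.real (cyl n u) * c ≤ μ.real (cyl n u ∩ L)) : ∀ᵐ x ∂μ, x ∈ L := by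
  have hcyl (n : ℕ) (u : ℕ → ℕ) : ENNReal.ofReal c * μ (cyl n u) ≤ μ.restrict L (cyl n u) := by
    rw [Measure.restrict_apply (measurableSet_cyl n u)]
    have := ENNReal.ofReal_le_ofReal (h n u)
    rwa [ENNReal.ofReal_mul measureReal_nonneg, ofReal_measureReal, ofReal_measureReal,
      mul_comm] at this
  have hinit (n : ℕ) (T : Set (Fin (n + 1) → ℕ)) :
      ENNReal.ofReal c * μ ((fun (x : ℕ → ℕ) (i : Fin (n + 1)) => x i) ⁻¹' T) ≤
        μ.restrict L ((fun (x : ℕ → ℕ) (i : Fin (n + 1)) => x i) ⁻¹' T) := by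
    have hun : (fun (x : ℕ → ℕ) (i : Fin (n + 1)) => x i) ⁻¹' T =
        ⋃ t ∈ T, cyl n (extendPath t) := by
      ext x
      simp [mem_cyl_extendPath]
    have hd : T.PairwiseDisjoint fun t => cyl n (extendPath t) := by
      intro s _ t _ hst
      exact Set.disjoint_left.2 fun x hs ht =>
        hst ((mem_cyl_extendPath.1 hs).symm.trans (mem_cyl_extendPath.1 ht))
    rw [hun, measure_biUnion (Set.to_countable T) hd fun t _ => measurableSet_cyl _ _,
      measure_biUnion (Set.to_countable T) hd fun t _ => measurableSet_cyl _ _,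
      ← ENNReal.tsum_mul_left]
    exact ENNReal.tsum_le_tsum fun t => hcyl _ _
  have hopen (O : Set (ℕ → ℕ)) (hO : IsOpen O) : ENNReal.ofReal c * μ O ≤ μ.restrict L O := by
    have hun : O = ⋃ n : ℕ, {x | cyl n x ⊆ O} := by
      ext x
      simp only [Set.mem_iUnion, Set.mem_ofPred_eq]
      constructor
      · intro hx
        obtain ⟨V, ⟨y, n, rfl⟩, hxV, hVO⟩ :=
          (PiNat.isTopologicalBasis_cylinders fun _ : ℕ => ℕ).exists_subset_of_mem_open hx hO
        refine ⟨n, fun z hz => hVO fun i hi => ?_⟩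
        rw [hz i hi.le]
        exact hxV i hi
      · rintro ⟨n, hn⟩
        exact hn fun k _ => rfl
    have hmono : Monotone fun n : ℕ => {x | cyl n x ⊆ O} := fun a b hab x hx z hz =>
      hx fun k hk => hz k (hk.trans hab)
    have hle (n : ℕ) : ENNReal.ofReal c * μ {x | cyl n x ⊆ O} ≤ μ.restrict L O := by
      have : {x | cyl n x ⊆ O} = (fun (x : ℕ → ℕ) (i : Fin (n + 1)) => x i) ⁻¹'
          ((fun (x : ℕ → ℕ) (i : Fin (n + 1)) => x i) '' {x | cyl n x ⊆ O}) := by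
        refine (Set.subset_preimage_image _ _).antisymm ?_
        rintro x ⟨y, hy, hyx⟩ z hz
        refine hy fun k hk => ?_
        rw [hz k hk]
        exact (congrFun hyx ⟨k, by omega⟩).symm
      have h1 := hinit n ((fun (x : ℕ → ℕ) (i : Fin (n + 1)) => x i) '' {x | cyl n x ⊆ O})
      rw [← this] at h1
      exact h1.trans (measure_mono fun x hx => hx fun k _ => rfl)
    conv_lhs => rw [hun, hmono.measure_iUnion, ENNReal.mul_iSup]
    exact iSup_le hle
  have hnull : ENNReal.ofReal c * μ Lᶜ ≤ 0 := by
    refine le_of_forall_gt fun ε hε => ?_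
    obtain ⟨O, hLO, hO, hlt⟩ := Set.exists_isOpen_lt_of_lt (μ := μ.restrict L) Lᶜ ε (by
      rwa [Measure.restrict_apply hL.compl, Set.compl_inter_self, measure_empty])
    exact (mul_le_mul_right (measure_mono hLO) _).trans_lt ((hopen O hO).trans_lt hlt)
  have : μ Lᶜ = 0 := by simpa [hc.not_ge] using hnull
  exact this

lemma nullMeasurableSet_of_measure_add_le {Ω : Type*} [MeasurableSpace Ω] {P : Measure Ω}
    [IsFiniteMeasure P] {A B C Z : Set Ω} (hA : NullMeasurableSet A P) (hBA : B ⊆ A)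
    (hcover : A ⊆ B ∪ C ∪ Z) (hZ : P Z = 0) (hadd : P B + P C ≤ P A) :
    NullMeasurableSet B P := by
  have hB := measurableSet_toMeasurable P B
  have hC := measurableSet_toMeasurable P C
  have hle : P A ≤ P (toMeasurable P B ∪ toMeasurable P C) := by
    calc P A ≤ P ((toMeasurable P B ∪ toMeasurable P C) ∪ Z) :=
          measure_mono (hcover.trans (Set.union_subset_union_left _
            (Set.union_subset_union (subset_toMeasurable _ _) (subset_toMeasurable _ _))))
      _ ≤ P (toMeasurable P B ∪ toMeasurable P C) + P Z := measure_union_le _ _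
      _ = _ := by rw [hZ, add_zero]
  have hinter : P (toMeasurable P B ∩ toMeasurable P C) = 0 := by
    have h := measure_union_add_inter (μ := P) (toMeasurable P B) hC
    rw [measure_toMeasurable, measure_toMeasurable] at h
    have h' : P (toMeasurable P B ∪ toMeasurable P C) + P (toMeasurable P B ∩ toMeasurable P C) ≤
        P (toMeasurable P B ∪ toMeasurable P C) + 0 := by
      rw [h, add_zero]
      exact hadd.trans hle
    exact nonpos_iff_eq_zero.1 ((ENNReal.add_le_add_iff_left (measure_ne_top _ _)).1 h')
  have hBeq : B = (toMeasurable P B ∩ A) \ ((toMeasurable P B ∩ A) \ B) := by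
    rw [Set.sdiff_sdiff_right_self]
    exact (Set.inter_eq_right.2 (Set.subset_inter (subset_toMeasurable _ _) hBA)).symm
  rw [hBeq]
  refine (hB.nullMeasurableSet.inter hA).diff (NullMeasurableSet.of_null ?_)
  refine measure_mono_null (t := (toMeasurable P B ∩ toMeasurable P C) ∪ Z) ?_
    (measure_union_null hinter hZ)
  rintro ω ⟨⟨h1, h2⟩, h3⟩
  rcases hcover h2 with (h | h) | h
  · exact absurd h h3
  · exact Or.inl ⟨h1, subset_toMeasurable _ _ h⟩
  · exact Or.inr h

section Path

variable {Ω : Type*} [MeasurableSpace Ω] {P : Measure Ω} {X : ℕ → Ω → ℕ} {p : ℕ → ℝ}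

lemma IsNNWalk.measure_cyl_succ (hX : IsNNWalk P X p 0)
    (hp : ∀ i, 1 ≤ i → 0 ≤ p i ∧ p i < 1 / 2) (n : ℕ) (u : ℕ → ℕ) (y : ℕ) :
    P ((fun ω k => X k ω) ⁻¹' cyl (n + 1) (Function.update u (n + 1) y)) =
      P ((fun ω k => X k ω) ⁻¹' cyl n u) * ENNReal.ofReal (step p (u n) y) := by
  by_cases hu : u 0 = 0
  · have h1 := hX.2 (n + 1) (Function.update u (n + 1) y)
      (by rwa [Function.update_of_ne (by omega)])
    have h2 := hX.2 n u hu
    rw [prod_step_update, ENNReal.ofReal_mul (prod_nonneg fun k _ => step_nonneg hp _ _),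
      ← h2] at h1
    exact h1
  · have h2 : (fun ω k => X k ω) ⁻¹' cyl n u = ∅ := by
      ext ω
      simp only [Set.mem_preimage, Set.mem_empty_iff_false, iff_false]
      exact fun h => hu ((h 0 (Nat.zero_le _)).symm.trans (hX.1 ω))
    have h1 : (fun ω k => X k ω) ⁻¹' cyl (n + 1) (Function.update u (n + 1) y) = ∅ := by
      refine Set.subset_empty_iff.1 (h2 ▸ ?_)
      exact fun ω hω => (mem_cyl_succ_update.1 hω).1
    rw [h1, h2, measure_empty, zero_mul]

lemma IsNNWalk.nullMeasurableSet_cyl [IsProbabilityMeasure P] (hX : IsNNWalk P X p 0)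
    (hp : ∀ i, 1 ≤ i → 0 ≤ p i ∧ p i < 1 / 2) (n : ℕ) (u : ℕ → ℕ) :
    NullMeasurableSet ((fun ω k => X k ω) ⁻¹' cyl n u) P := by
  induction n generalizing u with
  | zero =>
    have : (fun ω k => X k ω) ⁻¹' cyl 0 u = {_ω : Ω | 0 = u 0} := by
      ext ω
      simp [cyl, hX.1 ω]
    rw [this]
    exact (MeasurableSet.const _).nullMeasurableSet
  | succ n ih =>
    set C : ℕ → Set Ω := fun y =>
      (fun ω k => X k ω) ⁻¹' cyl (n + 1) (Function.update u (n + 1) y) with hC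
    have hsub (y : ℕ) : C y ⊆ (fun ω k => X k ω) ⁻¹' cyl n u :=
      fun ω hω => (mem_cyl_succ_update.1 hω).1
    have hnull {y : ℕ} (hy : step p (u n) y = 0) : P (C y) = 0 := by
      rw [hC, hX.measure_cyl_succ hp, hy, ENNReal.ofReal_zero, mul_zero]
    have hZ : P (⋃ y ∈ {y | step p (u n) y = 0}, C y) = 0 :=
      (measure_biUnion_null_iff (Set.to_countable _)).2 fun y hy => hnull hy
    have hcover : (fun ω k => X k ω) ⁻¹' cyl n u ⊆
        C (u n + 1) ∪ C (u n - 1) ∪ ⋃ y ∈ {y | step p (u n) y = 0}, C y := by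
      intro ω hω
      have hmem : ω ∈ C (X (n + 1) ω) := mem_cyl_succ_update.2 ⟨hω, rfl⟩
      by_cases h1 : X (n + 1) ω = u n + 1
      · exact Or.inl (Or.inl (h1 ▸ hmem))
      by_cases h2 : X (n + 1) ω = u n - 1
      · exact Or.inl (Or.inr (h2 ▸ hmem))
      refine Or.inr (Set.mem_biUnion ?_ hmem)
      rw [Set.mem_ofPred_eq, step, if_neg h1, if_neg (by omega)]
    have hadd : P (C (u n + 1)) + P (C (u n - 1)) ≤ P ((fun ω k => X k ω) ⁻¹' cyl n u) := by
      rw [hC, hX.measure_cyl_succ hp, hX.measure_cyl_succ hp, ← mul_add,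
        ← ENNReal.ofReal_add (step_nonneg hp _ _) (step_nonneg hp _ _), step_up, step_down]
      simp
    have hu : (fun ω k => X k ω) ⁻¹' cyl (n + 1) u = C (u (n + 1)) := by
      simp only [hC, Function.update_eq_self]
    rw [hu]
    by_cases h1 : u (n + 1) = u n + 1
    · rw [h1]
      exact nullMeasurableSet_of_measure_add_le (ih u) (hsub _) hcover hZ hadd
    by_cases h2 : u (n + 1) = u n - 1
    · rw [h2]
      rw [Set.union_comm (C (u n + 1))] at hcover
      rw [add_comm] at hadd
      exact nullMeasurableSet_of_measure_add_le (ih u) (hsub _) hcover hZ hadd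
    · refine NullMeasurableSet.of_null (hnull ?_)
      rw [step, if_neg h1, if_neg (by omega)]

lemma IsNNWalk.aemeasurable_path [IsProbabilityMeasure P] (hX : IsNNWalk P X p 0)
    (hp : ∀ i, 1 ≤ i → 0 ≤ p i ∧ p i < 1 / 2) : AEMeasurable (fun ω k => X k ω) P := by
  refine aemeasurable_pi_iff.2 fun n => NullMeasurable.aemeasurable fun s _ => ?_
  have : X n ⁻¹' s = ⋃ t ∈ {t : Fin (n + 1) → ℕ | t (Fin.last n) ∈ s},
      (fun ω k => X k ω) ⁻¹' cyl n (extendPath t) := by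
    ext ω
    simp [mem_cyl_extendPath]
  rw [this]
  exact NullMeasurableSet.biUnion (Set.to_countable _) fun t _ => hX.nullMeasurableSet_cyl hp n _

lemma IsNNWalk.isWalkLaw_map [IsProbabilityMeasure P] (hX : IsNNWalk P X p 0)
    (hp : ∀ i, 1 ≤ i → 0 ≤ p i ∧ p i < 1 / 2) :
    IsWalkLaw p (P.map fun ω k => X k ω) where
  extend n u y := by
    have hm := hX.aemeasurable_path hp
    rw [Measure.real, Measure.real, Measure.map_apply_of_aemeasurable hm (measurableSet_cyl _ _),
      Measure.map_apply_of_aemeasurable hm (measurableSet_cyl _ _), hX.measure_cyl_succ hp,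
      ENNReal.toReal_mul, ENNReal.toReal_ofReal (step_nonneg hp _ _)]

end Path

end NNRW

open NNRW
/-- for a transient chain with `p_R → 0`, a.s. `ξ(R,∞) ≥ M D(R,∞)` for
infinitely many `R`, for every `M > 0`. -/
theorem stmt12 (p : ℕ → ℝ) (hp : ∀ i, 1 ≤ i → 0 ≤ p i ∧ p i < 1 / 2)
    (htrans : Dinf p 0 < ⊤) (hplim : Tendsto p atTop (𝓝 0))
    (Ω : Type) [MeasurableSpace Ω] (P : Measure Ω) [IsProbabilityMeasure P]
    (X : ℕ → Ω → ℕ) (hX : IsNNWalk P X p 0) :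
    ∀ M : ℝ, 0 < M → ∀ᵐ ω ∂P, ∃ᶠ R : ℕ in atTop,
      ENNReal.ofReal M * Dinf p R ≤ localTime X R ω := by
  intro M hM
  have hm := hX.aemeasurable_path hp
  have : IsProbabilityMeasure (P.map fun ω k => X k ω) := Measure.isProbabilityMeasure_map hm
  have hA (R : ℕ) : MeasurableSet {x | ENNReal.ofReal M * Dinf p R ≤ visitsFrom R 0 x} :=
    measurableSet_le measurable_const (measurable_visitsFrom R 0)
  have hL : MeasurableSet {x : ℕ → ℕ | ∃ᶠ R in atTop,
      x ∈ {x | ENNReal.ofReal M * Dinf p R ≤ visitsFrom R 0 x}} := by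
    rw [setOf_frequently_eq]
    exact .iInter fun n => .biUnion (Set.to_countable _) fun R _ => hA R
  have h := ae_of_ae_map hm (ae_mem_of_cyl_le hL (Real.exp_pos _) fun n u =>
    mul_measureReal_le_inter_frequently hA (measurableSet_cyl n u)
      (eventually_measureReal_cyl_inter_ge hp htrans hplim (hX.isWalkLaw_map hp) hM n u))
  filter_upwards [h] with ω hω
  refine Frequently.mono hω fun R hR => ?_
  rw [visitsFrom_zero] at hR
  exact hR
end
end

section
/- Let p_R = B/(4R) (with the truncation convention) for some B > 1. Then with probability 1, limsup_{R→∞} (B−1) ξ(R,∞) / (2 R log log R) = 1 and limsup_{R→∞} (B−1) ξ(R,∞,↑) / (R log log R) = 1. -/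
open MeasureTheory Filter Finset
open scoped ENNReal NNReal Topology

noncomputable section

namespace NNRW

/-- The auxiliary state carried along a path `u` by the update rule `nxt`. -/
def stateOf {τ : Type*} (nxt : ℕ → ℕ → τ → τ) (t₀ : τ) (u : ℕ → ℕ) : ℕ → τ
  | 0 => t₀
  | n + 1 => nxt (u n) (u (n + 1)) (stateOf nxt t₀ u n)

lemma stateOf_congr {τ : Type*} (nxt : ℕ → ℕ → τ → τ) (t₀ : τ) {u v : ℕ → ℕ} {n : ℕ}
    (h : ∀ k ≤ n, u k = v k) : stateOf nxt t₀ u n = stateOf nxt t₀ v n := by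
  induction n with
  | zero => rfl
  | succ n ih =>
    simp only [stateOf]
    rw [ih fun k hk => h k (by omega), h n (by omega), h (n + 1) le_rfl]

/-- A superharmonic function of the walk together with its auxiliary state bounds the
probability of every event on which it is at least one. -/
theorem measure_le_of_superharmonic {Ω τ : Type*} [MeasurableSpace Ω] {P : Measure Ω}
    {X : ℕ → Ω → ℕ} {p : ℕ → ℝ} {b : ℕ} (hX : IsNNWalk P X p b)
    (hE0 : ∀ i, 0 ≤ E p i) (hE1 : ∀ i, E p i ≤ 1)
    (nxt : ℕ → ℕ → τ → τ) (t₀ : τ) (V : ℕ → ℕ → τ → ℝ≥0∞)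
    (Inv : ℕ → ℕ → τ → Prop) (S : ℕ → τ → Prop)
    (hup : ∀ k x t, Inv (k + 1) x t → Inv k (x + 1) (nxt x (x + 1) t))
    (hdown : ∀ k x t, Inv (k + 1) (x + 1) t → Inv k x (nxt (x + 1) x t))
    (hV : ∀ k x t, Inv (k + 1) x t →
      ENNReal.ofReal (E p x) * V k (x + 1) (nxt x (x + 1) t) +
        ENNReal.ofReal (1 - E p x) * V k (x - 1) (nxt x (x - 1) t) ≤ V (k + 1) x t)
    (hS : ∀ x t, Inv 0 x t → S x t → 1 ≤ V 0 x t) (n : ℕ) (h0 : Inv n b t₀) :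
    P {ω | S (X n ω) (stateOf nxt t₀ (fun k => X k ω) n)} ≤ V n b t₀ := by
  have key : ∀ (j m : ℕ) (u : ℕ → ℕ), m + j = n → u 0 = b →
      Inv j (u m) (stateOf nxt t₀ u m) →
      P {ω | (∀ k ≤ m, X k ω = u k) ∧ S (X n ω) (stateOf nxt t₀ (fun k => X k ω) n)} ≤
        ENNReal.ofReal (∏ k ∈ Finset.range m, step p (u k) (u (k + 1))) *
          V j (u m) (stateOf nxt t₀ u m) := by
    intro j
    induction j with
    | zero =>
      intro m u hm hu hI
      obtain rfl : m = n := by omega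
      by_cases hs : S (u m) (stateOf nxt t₀ u m)
      · calc _ ≤ P {ω | ∀ k ≤ m, X k ω = u k} := measure_mono fun ω h => h.1
          _ = _ := hX.2 m u hu
          _ = ENNReal.ofReal (∏ k ∈ Finset.range m, step p (u k) (u (k + 1))) * 1 := by simp
          _ ≤ _ := by gcongr; exact hS _ _ hI hs
      · have : {ω | (∀ k ≤ m, X k ω = u k) ∧
            S (X m ω) (stateOf nxt t₀ (fun k => X k ω) m)} = ∅ := by
          ext ω
          simp only [Set.mem_ofPred_eq, Set.mem_empty_iff_false, iff_false, not_and]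
          intro h
          rwa [h m le_rfl, stateOf_congr nxt t₀ h]
        rw [this]; simp
    | succ j ih =>
      intro m u hm hu hI
      set A : ℕ → Set Ω := fun y => {ω | (∀ k ≤ m + 1, X k ω = Function.update u (m + 1) y k) ∧
        S (X n ω) (stateOf nxt t₀ (fun k => X k ω) n)} with hA
      have hsub : {ω | (∀ k ≤ m, X k ω = u k) ∧
          S (X n ω) (stateOf nxt t₀ (fun k => X k ω) n)} ⊆ ⋃ y, A y := by
        intro ω hω
        refine Set.mem_iUnion.2 ⟨X (m + 1) ω, ?_, hω.2⟩
        intro k hk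
        rcases Nat.lt_or_ge k (m + 1) with h | h
        · rw [Function.update_of_ne (by omega)]; exact hω.1 k (by omega)
        · obtain rfl : k = m + 1 := by omega
          simp
      have hprod : ∀ y, ∏ k ∈ Finset.range (m + 1),
          step p (Function.update u (m + 1) y k) (Function.update u (m + 1) y (k + 1)) =
          (∏ k ∈ Finset.range m, step p (u k) (u (k + 1))) * step p (u m) y := by
        intro y
        rw [Finset.prod_range_succ]
        congr 1
        · refine Finset.prod_congr rfl fun k hk => ?_
          have := Finset.mem_range.1 hk
          rw [Function.update_of_ne (by omega), Function.update_of_ne (by omega)]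
        · rw [Function.update_of_ne (by omega), Function.update_self]
      have hst : ∀ y, stateOf nxt t₀ (Function.update u (m + 1) y) (m + 1) =
          nxt (u m) y (stateOf nxt t₀ u m) := by
        intro y
        simp only [stateOf, Function.update_self]
        rw [Function.update_of_ne (by omega)]
        congr 1
        refine stateOf_congr nxt t₀ fun k hk => ?_
        rw [Function.update_of_ne (by omega)]
      have hstep0 : ∀ x y, 0 ≤ step p x y := by
        intro x y
        unfold step
        split_ifs
        · exact hE0 x
        · linarith [hE1 x]
        · exact le_rfl
      have hnn : 0 ≤ ∏ k ∈ Finset.range m, step p (u k) (u (k + 1)) :=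
        Finset.prod_nonneg fun k _ => hstep0 _ _
      set w := ENNReal.ofReal (∏ k ∈ Finset.range m, step p (u k) (u (k + 1))) with hw
      have hAy : ∀ y, Inv j y (nxt (u m) y (stateOf nxt t₀ u m)) →
          P (A y) ≤ w * (ENNReal.ofReal (step p (u m) y) *
            V j y (nxt (u m) y (stateOf nxt t₀ u m))) := by
        intro y hy
        have := ih (m + 1) (Function.update u (m + 1) y) (by omega)
          (by rw [Function.update_of_ne (by omega)]; exact hu)
          (by rw [hst, Function.update_self]; exact hy)
        rw [hst, Function.update_self, hprod, ENNReal.ofReal_mul hnn, mul_assoc] at this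
        exact this
      have hA0 : ∀ y, step p (u m) y = 0 → P (A y) = 0 := by
        intro y hy
        refine le_antisymm ?_ zero_le
        calc P (A y) ≤ P {ω | ∀ k ≤ m + 1, X k ω = Function.update u (m + 1) y k} :=
              measure_mono fun ω h => h.1
          _ = 0 := by
            rw [hX.2 (m + 1) _ (by rw [Function.update_of_ne (by omega)]; exact hu), hprod, hy]
            simp
      have hup' := hAy (u m + 1) (hup _ _ _ hI)
      have hsu : step p (u m) (u m + 1) = E p (u m) := by simp [step]
      rw [hsu] at hup'
      have hdn' : P (⋃ y ∈ ({u m + 1}ᶜ : Set ℕ), A y) ≤ w * (ENNReal.ofReal (1 - E p (u m)) *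
          V j (u m - 1) (nxt (u m) (u m - 1) (stateOf nxt t₀ u m))) := by
        rcases Nat.eq_zero_or_pos (u m) with hx | hx
        · refine le_trans (le_of_eq ?_) zero_le
          refine (measure_biUnion_null_iff (Set.to_countable _)).2 fun y hy => hA0 y ?_
          have : y ≠ u m + 1 := hy
          simp [step, hx]
          omega
        · have hsub2 : (⋃ y ∈ ({u m + 1}ᶜ : Set ℕ), A y) ⊆ A (u m - 1) ∪
              ⋃ y ∈ ({u m + 1, u m - 1}ᶜ : Set ℕ), A y := by
            intro ω hω
            simp only [Set.mem_iUnion, Set.mem_union] at hω ⊢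
            obtain ⟨y, hy, hω⟩ := hω
            by_cases h : y = u m - 1
            · left; rwa [← h]
            · right; exact ⟨y, by
                simp only [Set.mem_compl_iff, Set.mem_insert_iff, Set.mem_singleton_iff] at hy ⊢
                tauto, hω⟩
          have hnull : P (⋃ y ∈ ({u m + 1, u m - 1}ᶜ : Set ℕ), A y) = 0 := by
            refine (measure_biUnion_null_iff (Set.to_countable _)).2 fun y hy => hA0 y ?_
            simp only [Set.mem_compl_iff, Set.mem_insert_iff, Set.mem_singleton_iff,
              not_or] at hy
            have h2 : y + 1 ≠ u m := by omega
            simp [step, hy.1, h2]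
          have hsd : step p (u m) (u m - 1) = 1 - E p (u m) := by
            have h1 : u m - 1 ≠ u m + 1 := by omega
            have h2 : u m - 1 + 1 = u m := by omega
            rw [step, if_neg h1, if_pos h2]
          have hd := hAy (u m - 1) (by
            have := hdown j (u m - 1) (stateOf nxt t₀ u m)
            rw [Nat.sub_add_cancel hx] at this
            exact this hI)
          rw [hsd] at hd
          calc _ ≤ P (A (u m - 1)) + P (⋃ y ∈ ({u m + 1, u m - 1}ᶜ : Set ℕ), A y) :=
                (measure_mono hsub2).trans (measure_union_le _ _)
            _ ≤ _ := by rw [hnull, add_zero]; exact hd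
      have hsub1 : (⋃ y, A y) ⊆ A (u m + 1) ∪ ⋃ y ∈ ({u m + 1}ᶜ : Set ℕ), A y := by
        intro ω hω
        simp only [Set.mem_iUnion, Set.mem_union] at hω ⊢
        obtain ⟨y, hω⟩ := hω
        by_cases h : y = u m + 1
        · left; rwa [← h]
        · right; exact ⟨y, h, hω⟩
      calc _ ≤ P (A (u m + 1)) + P (⋃ y ∈ ({u m + 1}ᶜ : Set ℕ), A y) :=
            (measure_mono (hsub.trans hsub1)).trans (measure_union_le _ _)
        _ ≤ _ := add_le_add hup' hdn'
        _ = w * (ENNReal.ofReal (E p (u m)) * V j (u m + 1) (nxt (u m) (u m + 1)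
              (stateOf nxt t₀ u m)) + ENNReal.ofReal (1 - E p (u m)) *
              V j (u m - 1) (nxt (u m) (u m - 1) (stateOf nxt t₀ u m))) := by rw [mul_add]
        _ ≤ _ := by gcongr; exact hV _ _ _ hI
  have := key n 0 (fun _ => b) (by omega) rfl h0
  simp only [Finset.range_zero, Finset.prod_empty, ENNReal.ofReal_one, one_mul] at this
  refine le_trans (measure_mono ?_) this
  intro ω hω
  refine ⟨fun k hk => ?_, hω⟩
  obtain rfl : k = 0 := by omega
  exact hX.1 ω

lemma ofReal_convex_comb {e a b : ℝ} (he0 : 0 ≤ e) (he1 : e ≤ 1) (ha : 0 ≤ a) (hb : 0 ≤ b) :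
    ENNReal.ofReal e * ENNReal.ofReal a + ENNReal.ofReal (1 - e) * ENNReal.ofReal b =
      ENNReal.ofReal (e * a + (1 - e) * b) := by
  have he : 0 ≤ 1 - e := by linarith
  rw [ENNReal.ofReal_add (mul_nonneg he0 ha) (mul_nonneg he hb), ENNReal.ofReal_mul he0,
    ENNReal.ofReal_mul he]

/-- Almost every path makes steps of size one only. -/
lemma ae_nearest_neighbour {Ω : Type*} [MeasurableSpace Ω] {P : Measure Ω}
    {X : ℕ → Ω → ℕ} {p : ℕ → ℝ} {b : ℕ} (hX : IsNNWalk P X p b)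
    (hE0 : ∀ i, 0 ≤ E p i) (hE1 : ∀ i, E p i ≤ 1) (hE : E p 0 = 1) :
    ∀ᵐ ω ∂P, ∀ n, X (n + 1) ω = X n ω + 1 ∨ X (n + 1) ω + 1 = X n ω := by
  rw [ae_all_iff]
  intro n
  classical
  set nxt : ℕ → ℕ → Prop → Prop := fun x y t => t ∨ ¬ (y = x + 1 ∨ y + 1 = x) with hnxt
  have h := measure_le_of_superharmonic hX hE0 hE1 nxt False
    (fun _ _ t => if t then 1 else 0) (fun _ _ _ => True) (fun _ t => t)
    (fun _ _ _ _ => trivial) (fun _ _ _ _ => trivial) ?_ ?_ (n + 1) trivial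
  · simp only [if_false, nonpos_iff_eq_zero] at h
    refine measure_mono_null ?_ h
    intro ω hω
    right
    exact hω
  · intro k x t _
    by_cases ht : t
    · simp only [hnxt, ht, true_or, if_true, mul_one]
      rw [← ENNReal.ofReal_add (hE0 x) (by linarith [hE1 x])]
      simp
    · rcases Nat.eq_zero_or_pos x with rfl | hx
      · simp [hnxt, ht, hE]
      · have h2 : x - 1 + 1 = x := by omega
        simp [hnxt, ht, h2]
  · intro x t _ ht
    simp [ht]

/-- Almost every path leaves every bounded set. -/
lemma ae_exists_le {Ω : Type*} [MeasurableSpace Ω] {P : Measure Ω}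
    {X : ℕ → Ω → ℕ} {p : ℕ → ℝ} (hX : IsNNWalk P X p 0)
    (hE0 : ∀ i, 1 / 2 ≤ E p i) (hE1 : ∀ i, E p i ≤ 1) (hE : E p 0 = 1) :
    ∀ᵐ ω ∂P, ∀ N, ∃ n, N ≤ X n ω := by
  rw [ae_all_iff]
  intro N
  rcases Nat.eq_zero_or_pos N with rfl | hN
  · simp
  classical
  set nxt : ℕ → ℕ → Prop → Prop := fun _ y t => t ∨ N ≤ y with hnxt
  set C : ℝ := (N : ℝ) ^ 2 + 1 with hC
  have hCpos : 1 ≤ C := by rw [hC]; nlinarith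
  have hN1 : (1 : ℝ) ≤ N := by exact_mod_cast hN
  set γ : ℝ := 1 - 1 / C with hγ
  have hγ0 : 0 ≤ γ := by
    rw [hγ]; have : 1 / C ≤ 1 := by rw [div_le_one] <;> linarith
    linarith
  have hγ1 : γ < 1 := by
    rw [hγ]; have : 0 < 1 / C := by positivity
    linarith
  have h := fun n => measure_le_of_superharmonic hX
    (fun i => by linarith [hE0 i]) hE1 nxt False
    (fun k x t => if t then 0 else ENNReal.ofReal (γ ^ k * (C - (x : ℝ) ^ 2)))
    (fun _ x t => ¬ t → x < N) (fun _ t => ¬ t)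
    (fun k x t _ => by simp only [hnxt]; intro h; push Not at h; exact h.2)
    (fun k x t _ => by simp only [hnxt]; intro h; push Not at h; exact h.2) ?_ ?_ n
    (fun _ => hN)
  · have hsub : ∀ n, {ω | ¬ ∃ n, N ≤ X n ω} ⊆
        {ω | ¬ stateOf nxt False (fun k => X k ω) n} := by
      intro n ω hω
      have hω' : ¬ ∃ n, N ≤ X n ω := hω
      push Not at hω'
      change ¬ stateOf nxt False (fun k => X k ω) n
      induction n with
      | zero => simp [stateOf]
      | succ n ih =>
        simp only [stateOf, hnxt, not_or, not_le]
        exact ⟨ih, hω' _⟩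
    have hb : ∀ n, P {ω | ¬ ∃ n, N ≤ X n ω} ≤ ENNReal.ofReal (γ ^ n * C) := by
      intro n
      refine (measure_mono (hsub n)).trans ((h n).trans ?_)
      simp
    have hl : Tendsto (fun n : ℕ => ENNReal.ofReal (γ ^ n * C)) atTop (𝓝 0) := by
      rw [← ENNReal.ofReal_zero]
      refine ENNReal.tendsto_ofReal ?_
      simpa using (tendsto_pow_atTop_nhds_zero_of_lt_one hγ0 hγ1).mul_const C
    exact le_antisymm (ge_of_tendsto' hl hb) zero_le
  · intro k x t hx
    by_cases ht : t
    · simp [hnxt, ht]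
    have hx := hx ht
    have hxN : (x : ℝ) ≤ N := by exact_mod_cast hx.le
    simp only [hnxt, ht, false_or, if_false]
    have hx1N : ((x + 1 : ℕ) : ℝ) ≤ N := by exact_mod_cast hx
    push_cast at hx1N
    have hpos1 : 0 ≤ C - ((x : ℝ) + 1) ^ 2 := by rw [hC]; nlinarith
    have hpos2 : 0 ≤ C - ((x - 1 : ℕ) : ℝ) ^ 2 := by
      have : ((x - 1 : ℕ) : ℝ) ≤ N := by exact_mod_cast (by omega)
      have h0 : (0 : ℝ) ≤ ((x - 1 : ℕ) : ℝ) := by positivity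
      rw [hC]; nlinarith
    have hp : 0 ≤ γ ^ k := by positivity
    calc _ ≤ ENNReal.ofReal (E p x) * ENNReal.ofReal (γ ^ k * (C - ((x + 1 : ℕ) : ℝ) ^ 2)) +
          ENNReal.ofReal (1 - E p x) * ENNReal.ofReal (γ ^ k * (C - ((x - 1 : ℕ) : ℝ) ^ 2)) := by
            gcongr <;> split_ifs <;> simp
      _ = ENNReal.ofReal (E p x * (γ ^ k * (C - ((x + 1 : ℕ) : ℝ) ^ 2)) +
          (1 - E p x) * (γ ^ k * (C - ((x - 1 : ℕ) : ℝ) ^ 2))) :=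
            ofReal_convex_comb (by linarith [hE0 x]) (hE1 x)
              (by push_cast; exact mul_nonneg hp hpos1) (mul_nonneg hp hpos2)
      _ ≤ _ := by
            apply ENNReal.ofReal_le_ofReal
            have hcore : E p x * (C - ((x : ℝ) + 1) ^ 2) +
                (1 - E p x) * (C - ((x - 1 : ℕ) : ℝ) ^ 2) ≤ C - (x : ℝ) ^ 2 - 1 := by
              rcases Nat.eq_zero_or_pos x with rfl | hx0
              · simp [hE]
              · rw [Nat.cast_sub hx0]
                push_cast
                have : (1 : ℝ) ≤ x := by exact_mod_cast hx0
                nlinarith [hE0 x]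
            have hcore2 : C - (x : ℝ) ^ 2 - 1 ≤ γ * (C - (x : ℝ) ^ 2) := by
              rw [hγ]
              have : 1 / C * (C - (x : ℝ) ^ 2) ≤ 1 := by
                rw [div_mul_eq_mul_div, div_le_one (by linarith)]; nlinarith [sq_nonneg (x : ℝ)]
              linarith
            have := mul_le_mul_of_nonneg_left (hcore.trans hcore2) hp
            rw [pow_succ γ k]
            push_cast
            linarith
  · intro x t hx ht
    have hx := hx ht
    have hxN : (x : ℝ) ≤ N := by exact_mod_cast hx.le
    simp only [ht, if_false]
    rw [← ENNReal.ofReal_one]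
    apply ENNReal.ofReal_le_ofReal
    have h0 : (0 : ℝ) ≤ x := by positivity
    rw [hC]; simp; nlinarith

/-- The expectation of `g (k + N)`, where `N` is the number of failures before the `w`-th success
in independent trials with success and failure probabilities `e` and `f`. -/
def negBin (e f : ℝ≥0∞) (g : ℕ → ℝ≥0∞) : ℕ → ℕ → ℝ≥0∞
  | 0, k => g k
  | w + 1, k => ∑' j : ℕ, e * f ^ j * negBin e f g w (k + j)

lemma negBin_succ (e f : ℝ≥0∞) (g : ℕ → ℝ≥0∞) (w k : ℕ) :
    negBin e f g (w + 1) k = e * negBin e f g w k + f * negBin e f g (w + 1) (k + 1) := by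
  rw [negBin, tsum_eq_zero_add' ENNReal.summable, negBin, ← ENNReal.tsum_mul_left]
  congr 1
  · simp
  · refine tsum_congr fun j => ?_
    rw [show k + (j + 1) = k + 1 + j by ring, pow_succ]
    ring

lemma negBin_shift (e f : ℝ≥0∞) (g : ℕ → ℝ≥0∞) (w k c : ℕ) :
    negBin e f g w (k + c) = negBin e f (fun j => g (j + c)) w k := by
  induction w generalizing k with
  | zero => rfl
  | succ w ih =>
    simp only [negBin]
    refine tsum_congr fun j => ?_
    rw [← ih, add_right_comm]

lemma negBin_linear (e f a b : ℝ≥0∞) (g h : ℕ → ℝ≥0∞) (w k : ℕ) :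
    negBin e f (fun j => a * g j + b * h j) w k =
      a * negBin e f g w k + b * negBin e f h w k := by
  induction w generalizing k with
  | zero => rfl
  | succ w ih =>
    simp only [negBin, ih]
    rw [← ENNReal.tsum_mul_left, ← ENNReal.tsum_mul_left, ← ENNReal.tsum_add]
    exact tsum_congr fun j => by ring

lemma negBin_mono (e f : ℝ≥0∞) {g h : ℕ → ℝ≥0∞} (hgh : ∀ j, g j ≤ h j) (w k : ℕ) :
    negBin e f g w k ≤ negBin e f h w k := by
  induction w generalizing k with
  | zero => exact hgh k
  | succ w ih =>
    simp only [negBin]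
    exact ENNReal.tsum_le_tsum fun j => by gcongr; exact ih _

/-- Generating function of the negative binomial law. -/
lemma negBin_pow (e f c s : ℝ≥0∞) (w k : ℕ) :
    negBin e f (fun j => c * s ^ j) w k = c * s ^ k * (e * (1 - f * s)⁻¹) ^ w := by
  induction w generalizing k with
  | zero => simp [negBin]
  | succ w ih =>
    simp only [negBin, ih]
    rw [← ENNReal.tsum_geometric, pow_succ, ← ENNReal.tsum_mul_left, ← ENNReal.tsum_mul_left,
      ← ENNReal.tsum_mul_left]
    exact tsum_congr fun j => by rw [pow_add, mul_pow]; ring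

lemma negBin_one {e f : ℝ≥0∞} (hef : e + f = 1) (he : e ≠ 0) (w k : ℕ) :
    negBin e f (fun _ => 1) w k = 1 := by
  have h := negBin_pow e f 1 1 w k
  simp only [one_pow, mul_one] at h
  have hf : f ≠ ⊤ := fun h => by simp [h] at hef
  have he' : e ≠ ⊤ := fun h => by simp [h] at hef
  rw [h, show 1 - f = e by rw [← hef, ENNReal.add_sub_cancel_right hf],
    ENNReal.mul_inv_cancel he he', one_pow, one_mul]

/-- For the walk at `x` with numbers of upcrossings `z` so far, the conditional probability,
given that there will be `m` more upcrossings at `R`, that eventually the number of upcrossings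
at some site `i ≤ R` satisfies `Q i`. -/
def upProb (p : ℕ → ℝ) (Q : ℕ → ℕ → Bool) (x : ℕ) (z : ℕ → ℕ) : ℕ → ℕ → ℝ≥0∞
  | 0, m => if Q 0 (z 0 + m) then 1 else 0
  | R + 1, m => if Q (R + 1) (z (R + 1) + m) then 1 else
      negBin (ENNReal.ofReal (E p (R + 1))) (ENNReal.ofReal (1 - E p (R + 1)))
        (upProb p Q x z R) m (if x ≤ R then 1 else 0)

lemma upProb_congr (p : ℕ → ℝ) (Q : ℕ → ℕ → Bool) {x y R : ℕ} {z z' : ℕ → ℕ}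
    (hx : R ≤ x) (hy : R ≤ y) (hz : ∀ i ≤ R, z i = z' i) :
    upProb p Q x z R = upProb p Q y z' R := by
  induction R with
  | zero => funext m; simp only [upProb, hz 0 le_rfl]
  | succ R ih =>
    funext m
    simp only [upProb]
    rw [ih (by omega) (by omega) fun i hi => hz i (by omega), hz (R + 1) le_rfl,
      if_neg (by omega : ¬ x ≤ R), if_neg (by omega : ¬ y ≤ R)]

lemma upProb_eq_one {p : ℕ → ℝ} {Q : ℕ → ℕ → Bool} (hE0 : ∀ i, 0 < E p i) (hE1 : ∀ i, E p i ≤ 1)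
    (hQ : ∀ R m m', m ≤ m' → Q R m → Q R m') {x : ℕ} {z : ℕ → ℕ} {R₀ R : ℕ} (hR : R₀ ≤ R)
    (h : Q R₀ (z R₀)) (m : ℕ) : upProb p Q x z R m = 1 := by
  induction R, hR using Nat.le_induction generalizing m with
  | base =>
    have := hQ R₀ (z R₀) (z R₀ + m) (by omega) h
    cases R₀ <;> simp [upProb, this]
  | succ R hR ih =>
    simp only [upProb]
    split_ifs
    · rfl
    all_goals
      rw [show upProb p Q x z R = fun _ => 1 from funext ih]
      refine negBin_one ?_ (by simpa using hE0 _) _ _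
      rw [← ENNReal.ofReal_add (hE0 _).le (by linarith [hE1 (R + 1)])]
      simp

/-- One-step analysis of `upProb`. -/
lemma upProb_step {p : ℕ → ℝ} (Q : ℕ → ℕ → Bool) (hE0 : ∀ i, 0 < E p i) (hE1 : ∀ i, E p i ≤ 1)
    {x R : ℕ} (z : ℕ → ℕ) (hR : x ≤ R) (j : ℕ) :
    upProb p Q x z R (j + 1) =
      ENNReal.ofReal (E p x) * upProb p Q (x + 1) (Function.update z x (z x + 1)) R
        (j + if x + 1 ≤ R then 1 else 0) +
      ENNReal.ofReal (1 - E p x) * upProb p Q (x - 1) z R (j + 1) := by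
  have hef : ENNReal.ofReal (E p x) + ENNReal.ofReal (1 - E p x) = 1 := by
    rw [← ENNReal.ofReal_add (hE0 _).le (by linarith [hE1 x])]; simp
  induction R, hR using Nat.le_induction generalizing j with
  | base =>
    rw [if_neg (by omega), add_zero]
    cases x with
    | zero =>
      simp only [upProb, Function.update_self]
      rw [show z 0 + 1 + j = z 0 + (j + 1) by ring]
      simp [E]
    | succ x =>
      simp only [upProb, Function.update_self]
      rw [show z (x + 1) + 1 + j = z (x + 1) + (j + 1) by ring]
      split_ifs
      · simpa using hef.symm
      all_goals try omega
      rw [upProb_congr p Q (x := x + 1 + 1) (y := x + 1) (z' := z) (by omega) (by omega)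
        (fun i hi => by rw [Function.update_of_ne (by omega)]),
        upProb_congr p Q (x := x + 1 - 1) (y := x + 1) (z' := z) (by omega) (by omega)
        (fun i hi => rfl)]
      exact negBin_succ _ _ _ _ _
  | succ R hR ih =>
    rw [if_pos (by omega)]
    simp only [upProb]
    rw [Function.update_of_ne (by omega : R + 1 ≠ x), if_pos hR, if_pos (by omega : x - 1 ≤ R)]
    by_cases hq : Q (R + 1) (z (R + 1) + (j + 1)) = true
    · simpa [hq] using hef.symm
    rw [if_neg hq, if_neg hq, if_neg hq, ← zero_add 1, negBin_shift _ _ (upProb p Q x z R),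
      negBin_shift _ _ (upProb p Q (x - 1) z R), funext ih, negBin_linear,
      ← negBin_shift _ _ (upProb p Q (x + 1) (Function.update z x (z x + 1)) R)]
    simp only [zero_add]

/-- Update rule for the numbers of upcrossings. -/
def upNext (x y : ℕ) (z : ℕ → ℕ) : ℕ → ℕ :=
  if y = x + 1 then Function.update z x (z x + 1) else z

lemma stateOf_upNext (u : ℕ → ℕ) (n R : ℕ) :
    stateOf upNext (fun _ => 0) u n R =
      #{k ∈ Finset.range n | u k = R ∧ u (k + 1) = R + 1} := by
  induction n with
  | zero => simp [stateOf]
  | succ n ih =>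
    rw [Finset.range_add_one, Finset.filter_insert]
    simp only [stateOf, upNext]
    by_cases h : u (n + 1) = u n + 1
    · by_cases hR : u n = R
      · subst hR
        simp [h, ih]
      · simp [h, hR, Function.update_of_ne (Ne.symm hR), ih]
    · rw [if_neg h, if_neg (by rintro ⟨rfl, h2⟩; exact h h2), ih]

lemma measure_exists_upcross_le {Ω : Type*} [MeasurableSpace Ω] {P : Measure Ω}
    {X : ℕ → Ω → ℕ} {p : ℕ → ℝ} (hX : IsNNWalk P X p 0)
    (hE0 : ∀ i, 0 < E p i) (hE1 : ∀ i, E p i ≤ 1) {Q : ℕ → ℕ → Bool}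
    (hQ : ∀ R m m', m ≤ m' → Q R m → Q R m') (n : ℕ) :
    P {ω | ∃ R ≤ n, Q R #{k ∈ Finset.range n | X k ω = R ∧ X (k + 1) ω = R + 1}} ≤
      upProb p Q 0 (fun _ => 0) n 1 := by
  have h := measure_le_of_superharmonic hX (fun i => (hE0 i).le) hE1 upNext (fun _ => 0)
    (fun _ x z => upProb p Q x z n 1) (fun k x _ => x + k ≤ n)
    (fun _ z => ∃ R ≤ n, Q R (z R)) (fun k x t h => by omega) (fun k x t h => by omega)
    ?_ ?_ n (by omega)
  · simpa only [stateOf_upNext] using h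
  · intro k x z hx
    have h1 : upNext x (x + 1) z = Function.update z x (z x + 1) := by simp [upNext]
    have h2 : upNext x (x - 1) z = z := by
      rw [upNext, if_neg (by omega)]
    have := upProb_step Q hE0 hE1 z (by omega : x ≤ n) 0
    rw [if_pos (by omega)] at this
    simp only [h1, h2]
    exact this.ge
  · rintro x z - ⟨R, hR, hq⟩
    exact (upProb_eq_one hE0 hE1 hQ hR hq 1).ge

lemma upProb_eq_zero (p : ℕ → ℝ) {Q : ℕ → ℕ → Bool} {a R : ℕ} (hR : R < a)
    (hQ : ∀ R m, R < a → Q R m = false) (x : ℕ) (z : ℕ → ℕ) (m : ℕ) :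
    upProb p Q x z R m = 0 := by
  induction R generalizing m with
  | zero => simp [upProb, hQ 0 _ hR]
  | succ R ih =>
    have := negBin_pow (ENNReal.ofReal (E p (R + 1))) (ENNReal.ofReal (1 - E p (R + 1))) 0 0
    simp only [zero_mul] at this
    simp [upProb, hQ (R + 1) _ hR, funext (ih (by omega)), this]

lemma upProb_le {p : ℕ → ℝ} (hE0 : ∀ i, 0 < E p i) (hE1 : ∀ i, E p i ≤ 1)
    {Q : ℕ → ℕ → Bool} {a : ℕ} {y : ℕ → ℝ} {c : ℝ} (hc : 0 ≤ c)
    (hy : ∀ R, a ≤ R → 0 < y R) (hanti : ∀ R, a ≤ R → y (R + 1) ≤ y R)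
    (hharm : ∀ R, a ≤ R → (1 - E p (R + 1)) * (y R - y (R + 1)) =
      E p (R + 1) * (y (R + 1) - y (R + 2)))
    (hQ0 : ∀ R m, R < a → Q R m = false)
    (hQ1 : ∀ R m, a ≤ R → Q R m → 1 ≤ c * (y R / y (R + 1)) ^ m) {R : ℕ} (hR : a ≤ R) (m : ℕ) :
    upProb p Q 0 (fun _ => 0) R m ≤
      ENNReal.ofReal (c * (y a / y R) * (y R / y (R + 1)) ^ m) := by
  have hya : ∀ R, a ≤ R → 1 ≤ y a / y R := by
    intro R hR
    rw [one_le_div (hy R hR)]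
    induction R, hR using Nat.le_induction with
    | base => exact le_rfl
    | succ R hR ih => exact (hanti R hR).trans ih
  have hq : ∀ R m, a ≤ R → Q R m →
      1 ≤ ENNReal.ofReal (c * (y a / y R) * (y R / y (R + 1)) ^ m) := by
    intro R m hR hq
    rw [← ENNReal.ofReal_one]
    apply ENNReal.ofReal_le_ofReal
    calc 1 ≤ c * (y R / y (R + 1)) ^ m := hQ1 R m hR hq
      _ = c * 1 * (y R / y (R + 1)) ^ m := by ring
      _ ≤ _ := by
        have := hy R hR
        have := hy (R + 1) (by omega)
        gcongr
        exact hya R hR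
  induction R, hR using Nat.le_induction generalizing m with
  | base =>
    cases a with
    | zero =>
      simp only [upProb, zero_add]
      split_ifs with h
      · exact hq 0 m le_rfl h
      · exact zero_le
    | succ a =>
      simp only [upProb, zero_add]
      by_cases h : Q (a + 1) m = true
      · rw [if_pos h]; exact hq _ m le_rfl h
      · have := negBin_pow (ENNReal.ofReal (E p (a + 1))) (ENNReal.ofReal (1 - E p (a + 1))) 0 0
        simp only [zero_mul] at this
        simp [h, funext (upProb_eq_zero p (Nat.lt_succ_self a) hQ0 0 (fun _ => 0)), this]
  | succ R hR ih =>
    simp only [upProb, zero_add]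
    by_cases h : Q (R + 1) m = true
    · rw [if_pos h]; exact hq _ m (by omega) h
    rw [if_neg h, if_pos (Nat.zero_le R)]
    have y0 := hy a le_rfl
    have y1 := hy R hR
    have y2 := hy (R + 1) (by omega)
    have y3 := hy (R + 2) (by omega)
    have hm := hharm R hR
    have e0 := hE0 (R + 1)
    have f0 : 0 ≤ 1 - E p (R + 1) := by linarith [hE1 (R + 1)]
    set e := E p (R + 1)
    have hden : 1 - (1 - e) * (y R / y (R + 1)) = e * (y (R + 2) / y (R + 1)) := by
      field_simp
      linarith
    have hgen : ENNReal.ofReal e *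
        (1 - ENNReal.ofReal (1 - e) * ENNReal.ofReal (y R / y (R + 1)))⁻¹ =
          ENNReal.ofReal (y (R + 1) / y (R + 2)) := by
      rw [← ENNReal.ofReal_mul f0, ← ENNReal.ofReal_one, ← ENNReal.ofReal_sub _ (by positivity),
        hden, ← ENNReal.ofReal_inv_of_pos (by positivity), ← ENNReal.ofReal_mul e0.le]
      congr 1
      field_simp
    calc negBin (ENNReal.ofReal e) (ENNReal.ofReal (1 - e)) (upProb p Q 0 (fun _ => 0) R) m 1
        ≤ negBin (ENNReal.ofReal e) (ENNReal.ofReal (1 - e))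
          (fun j => ENNReal.ofReal (c * (y a / y R)) * ENNReal.ofReal (y R / y (R + 1)) ^ j) m 1 := by
          refine negBin_mono _ _ (fun j => (ih j).trans (le_of_eq ?_)) _ _
          rw [ENNReal.ofReal_mul (by positivity), ENNReal.ofReal_pow (by positivity)]
      _ = _ := by
          rw [negBin_pow, hgen, pow_one, ← ENNReal.ofReal_pow (by positivity),
            ← ENNReal.ofReal_mul (by positivity), ← ENNReal.ofReal_mul (by positivity)]
          congr 2
          field_simp

/-- Maximal inequality for the total numbers of upcrossings over a range of sites, in terms
of a positive harmonic function `y` of the walk. -/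
theorem measure_exists_le_upcross {Ω : Type*} [MeasurableSpace Ω] {P : Measure Ω}
    {X : ℕ → Ω → ℕ} {p : ℕ → ℝ} (hX : IsNNWalk P X p 0)
    (hE0 : ∀ i, 0 < E p i) (hE1 : ∀ i, E p i ≤ 1)
    {a b : ℕ} {l : ℕ → ℝ} {y : ℕ → ℝ} {c y₀ : ℝ} (hc : 0 ≤ c) (hy₀ : 0 < y₀)
    (hy : ∀ R, a ≤ R → y₀ ≤ y R) (hanti : ∀ R, a ≤ R → y (R + 1) ≤ y R)
    (hharm : ∀ R, a ≤ R → (1 - E p (R + 1)) * (y R - y (R + 1)) =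
      E p (R + 1) * (y (R + 1) - y (R + 2)))
    (hl : ∀ R m, a ≤ R → R < b → l R < (m : ℕ) → 1 ≤ c * (y R / y (R + 1)) ^ m) :
    P {ω | ∃ R, a ≤ R ∧ R < b ∧ ENNReal.ofReal (l R) < upcross X R ω} ≤
      ENNReal.ofReal (c * (y a / y₀)) := by
  classical
  set Q : ℕ → ℕ → Bool := fun R m => decide (a ≤ R ∧ R < b ∧ l R < m) with hQdef
  set S : ℕ → Set Ω := fun n =>
    {ω | ∃ R ≤ n, Q R #{k ∈ Finset.range n | X k ω = R ∧ X (k + 1) ω = R + 1}} with hS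
  have hQ : ∀ R m m', m ≤ m' → Q R m → Q R m' := by
    intro R m m' hm h
    simp only [hQdef, decide_eq_true_eq] at h ⊢
    exact ⟨h.1, h.2.1, h.2.2.trans_le (by exact_mod_cast hm)⟩
  have hypos : ∀ R, a ≤ R → 0 < y R := fun R hR => hy₀.trans_le (hy R hR)
  have hSn : ∀ n, a ≤ n → P (S n) ≤ ENNReal.ofReal (c * (y a / y₀)) := by
    intro n hn
    refine (measure_exists_upcross_le hX hE0 hE1 hQ n).trans
      ((upProb_le hE0 hE1 hc hypos hanti hharm ?_ ?_ hn 1).trans ?_)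
    · intro R m hR
      simp only [hQdef, decide_eq_false_iff_not]
      omega
    · intro R m hR h
      simp only [hQdef, decide_eq_true_eq] at h
      exact hl R m h.1 h.2.1 h.2.2
    · apply ENNReal.ofReal_le_ofReal
      have h1 := hypos n hn
      have h2 := hypos (n + 1) (by omega)
      have h3 := hypos a le_rfl
      rw [pow_one, mul_assoc, div_mul_div_cancel₀ h1.ne']
      gcongr
      exact hy _ (by omega)
  have hmono : Monotone S := by
    refine monotone_nat_of_le_succ fun n ω hω => ?_
    obtain ⟨R, hR, h⟩ := hω
    refine ⟨R, by omega, hQ _ _ _ (Finset.card_le_card ?_) h⟩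
    exact Finset.filter_subset_filter _ (Finset.range_mono (by omega))
  have hsub : {ω | ∃ R, a ≤ R ∧ R < b ∧ ENNReal.ofReal (l R) < upcross X R ω} ⊆
      ⋃ n, S n := by
    rintro ω ⟨R, h1, h2, h3⟩
    rw [upcross, ENNReal.tsum_eq_iSup_nat, lt_iSup_iff] at h3
    obtain ⟨n, hn⟩ := h3
    have hcount : ∑ k ∈ Finset.range n, Set.indicator {k | X k ω = R ∧ X (k + 1) ω = R + 1}
        (fun _ => (1 : ℝ≥0∞)) k =
        ((#{k ∈ Finset.range n | X k ω = R ∧ X (k + 1) ω = R + 1} : ℕ) : ℝ≥0∞) := by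
      rw [Finset.card_filter]
      push_cast
      exact Finset.sum_congr rfl fun k _ => by simp [Set.indicator_apply]
    rw [hcount, ← ENNReal.ofReal_natCast, ENNReal.ofReal_lt_ofReal_iff'] at hn
    refine Set.mem_iUnion.2 ⟨max n R, R, le_max_right n R, ?_⟩
    refine hQ _ _ _ (Finset.card_le_card
      (Finset.filter_subset_filter _ (Finset.range_mono (le_max_left n R)))) ?_
    simp only [hQdef, decide_eq_true_eq]
    exact ⟨h1, h2, hn.1⟩
  calc _ ≤ P (⋃ n, S n) := measure_mono hsub
    _ = ⨆ n, P (S n) := hmono.measure_iUnion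
    _ ≤ _ := iSup_le fun n => (measure_mono (hmono (le_max_left n a))).trans
      (hSn _ (le_max_right n a))

/-- A decreasing harmonic function (on the sites beyond `i₀`) of the walk with `p i = B / (4 i)`. -/
def harm (B : ℝ) (i₀ x : ℕ) : ℝ := ∏ i ∈ Finset.Ico i₀ x, ((i : ℝ) + 1 - B / 2) / (i + B / 2)

section Harm

variable {B : ℝ} {i₀ : ℕ}

lemma harm_succ {x : ℕ} (hx : i₀ ≤ x) :
    harm B i₀ (x + 1) = harm B i₀ x * (((x : ℝ) + 1 - B / 2) / (x + B / 2)) := by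
  rw [harm, Finset.prod_Ico_succ_top hx, harm]

lemma harm_pos (hB : 1 < B) (hi : B < 2 * i₀) (x : ℕ) : 0 < harm B i₀ x := by
  refine Finset.prod_pos fun i hi' => ?_
  have : (i₀ : ℝ) ≤ i := by exact_mod_cast (Finset.mem_Ico.1 hi').1
  apply div_pos <;> linarith

lemma harm_sub (hB : 1 < B) {x : ℕ} (hx : i₀ ≤ x) :
    harm B i₀ x - harm B i₀ (x + 1) = harm B i₀ x * ((B - 1) / (x + B / 2)) := by
  rw [harm_succ hx]
  have : 0 < (x : ℝ) + B / 2 := by positivity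
  field_simp
  ring

lemma harm_antitone_step (hB : 1 < B) (hi : B < 2 * i₀) {x : ℕ} (hx : i₀ ≤ x) :
    harm B i₀ (x + 1) ≤ harm B i₀ x := by
  have h := harm_sub hB hx
  have : 0 ≤ harm B i₀ x * ((B - 1) / (x + B / 2)) :=
    mul_nonneg (harm_pos hB hi x).le (div_nonneg (by linarith) (by positivity))
  linarith

lemma harm_anti (hB : 1 < B) (hi : B < 2 * i₀) {x y : ℕ} (hx : i₀ ≤ x) (hxy : x ≤ y) :
    harm B i₀ y ≤ harm B i₀ x := by
  induction y, hxy using Nat.le_induction with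
  | base => exact le_rfl
  | succ y hy ih => exact (harm_antitone_step hB hi (hx.trans hy)).trans ih

lemma harm_harmonic {p : ℕ → ℝ} (hB : 1 < B)
    (hE : ∀ i, i₀ ≤ i → E p i = 1 / 2 + B / (4 * (i : ℝ))) {x : ℕ} (hx : i₀ ≤ x) :
    (1 - E p (x + 1)) * (harm B i₀ x - harm B i₀ (x + 1)) =
      E p (x + 1) * (harm B i₀ (x + 1) - harm B i₀ (x + 2)) := by
  rw [harm_sub hB hx, harm_sub hB (by omega : i₀ ≤ x + 1), harm_succ hx, hE (x + 1) (by omega)]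
  have h1 : 0 < (x : ℝ) + B / 2 := by positivity
  have h2 : 0 < (x : ℝ) + 1 + B / 2 := by positivity
  push_cast
  field_simp
  ring

/-- `harm` decays at most polynomially. -/
lemma harm_mul_pow_le (hB : 1 < B) (hi : B < 2 * i₀) {K : ℕ} (hK : 2 * B ≤ K) {a R : ℕ}
    (ha : i₀ ≤ a) (haB : B ≤ a) (hR : a ≤ R) :
    harm B i₀ a * (a : ℝ) ^ K ≤ harm B i₀ R * (R : ℝ) ^ K := by
  induction R, hR using Nat.le_induction with
  | base => exact le_rfl
  | succ R hR ih =>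
    refine ih.trans ?_
    rw [harm_succ (ha.trans hR)]
    have hRB : B ≤ R := haB.trans (by exact_mod_cast hR)
    have hR0 : 0 < (R : ℝ) := by linarith
    have h1 : 0 < (R : ℝ) + B / 2 := by positivity
    have h2 : 0 < (R : ℝ) + 1 - B / 2 := by linarith
    have hber : 1 + (K : ℝ) * (1 / R) ≤ (1 + 1 / (R : ℝ)) ^ K :=
      one_add_mul_le_pow (by have : 0 < 1 / (R : ℝ) := by positivity
                             linarith) K
    have hpow : ((R + 1 : ℕ) : ℝ) ^ K = (R : ℝ) ^ K * (1 + 1 / (R : ℝ)) ^ K := by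
      rw [← mul_pow]; congr 1; push_cast; field_simp
    have hmain : 1 ≤ ((R : ℝ) + 1 - B / 2) / (R + B / 2) * (1 + 1 / (R : ℝ)) ^ K := by
      refine le_trans ?_ (mul_le_mul_of_nonneg_left hber (by positivity))
      rw [div_mul_eq_mul_div, le_div_iff₀ h1]
      have : ((R : ℝ) + 1 - B / 2) * (1 + K * (1 / R)) =
          ((R : ℝ) + 1 - B / 2) + ((R : ℝ) + 1 - B / 2) * K / R := by ring
      rw [this]
      have : B - 1 ≤ ((R : ℝ) + 1 - B / 2) * K / R := by
        rw [le_div_iff₀ hR0]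
        nlinarith
      linarith
    rw [hpow]
    have h3 := harm_pos hB hi R
    calc harm B i₀ R * (R : ℝ) ^ K = harm B i₀ R * (R : ℝ) ^ K * 1 := by ring
      _ ≤ harm B i₀ R * (R : ℝ) ^ K *
          (((R : ℝ) + 1 - B / 2) / (R + B / 2) * (1 + 1 / (R : ℝ)) ^ K) := by gcongr
      _ = _ := by ring

lemma harm_le_two_pow_mul (hB : 1 < B) (hi : B < 2 * i₀) {K : ℕ} (hK : 2 * B ≤ K) {a R : ℕ}
    (ha : i₀ ≤ a) (haB : B ≤ a) (hR : a ≤ R) (hR2 : R ≤ 2 * a) :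
    harm B i₀ a ≤ 2 ^ K * harm B i₀ R := by
  have ha0 : 0 < (a : ℝ) := by linarith
  have h := harm_mul_pow_le hB hi hK ha haB hR
  have h2 : (R : ℝ) ^ K ≤ 2 ^ K * (a : ℝ) ^ K := by
    rw [← mul_pow]
    gcongr
    exact_mod_cast hR2
  have h3 := harm_pos hB hi R
  have h4 : 0 < (a : ℝ) ^ K := by positivity
  refine le_of_mul_le_mul_right (h.trans ?_) h4
  calc _ ≤ harm B i₀ R * (2 ^ K * (a : ℝ) ^ K) := by gcongr
    _ = _ := by ring

/-- Doubling the site decreases `harm` by a constant factor. -/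
lemma harm_two_mul_le (hB : 1 < B) (hi : B < 2 * i₀) {a : ℕ} (ha : i₀ ≤ a) :
    harm B i₀ (2 * a) * (1 + (B - 1) / 3) ≤ harm B i₀ a := by
  have hi' : (i₀ : ℝ) ≤ a := by exact_mod_cast ha
  have ha0 : 0 < (a : ℝ) := by linarith
  have hG := harm_pos hB hi (2 * a)
  have key : ∀ j ≤ a, harm B i₀ (2 * a) * (1 + j * ((B - 1) / (3 * a))) ≤
      harm B i₀ (2 * a - j) := by
    intro j
    induction j with
    | zero => simp
    | succ j ih =>
      intro hj
      have h1 := ih (by omega)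
      have h2 := harm_sub (i₀ := i₀) hB (x := 2 * a - (j + 1)) (by omega)
      rw [show 2 * a - (j + 1) + 1 = 2 * a - j by omega] at h2
      have h3 := harm_anti hB hi (x := 2 * a - (j + 1)) (y := 2 * a) (by omega) (by omega)
      have h4 : ((2 * a - (j + 1) : ℕ) : ℝ) ≤ 2 * a := by exact_mod_cast Nat.sub_le _ _
      have h5 : (B - 1) / (3 * a) ≤ (B - 1) / (((2 * a - (j + 1) : ℕ) : ℝ) + B / 2) := by
        apply div_le_div_of_nonneg_left (by linarith) (by positivity)
        linarith
      have h6 : harm B i₀ (2 * a) * ((B - 1) / (3 * a)) ≤ harm B i₀ (2 * a - (j + 1)) *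
          ((B - 1) / (((2 * a - (j + 1) : ℕ) : ℝ) + B / 2)) := by
        have : 0 ≤ (B - 1) / (3 * (a : ℝ)) := div_nonneg (by linarith) (by positivity)
        have := harm_pos hB hi (2 * a - (j + 1))
        gcongr
      push_cast
      linarith
  have := key a le_rfl
  rw [show 2 * a - a = a by omega, show (a : ℝ) * ((B - 1) / (3 * a)) = (B - 1) / 3 by
    field_simp] at this
  exact this

lemma harm_two_pow_mul_le (hB : 1 < B) (hi : B < 2 * i₀) (j : ℕ) {a : ℕ} (ha : i₀ ≤ a) :
    harm B i₀ (2 ^ j * a) * (1 + (B - 1) / 3) ^ j ≤ harm B i₀ a := by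
  induction j with
  | zero => simp
  | succ j ih =>
    refine le_trans ?_ ih
    have h1 : a ≤ 2 ^ j * a := Nat.le_mul_of_pos_left _ (by positivity)
    have h := harm_two_mul_le hB hi (ha.trans h1)
    rw [show 2 ^ (j + 1) * a = 2 * (2 ^ j * a) by ring, pow_succ]
    have h2 : 0 ≤ (1 + (B - 1) / 3) ^ j := pow_nonneg (by linarith) j
    nlinarith [mul_le_mul_of_nonneg_right h h2]

end Harm

lemma one_le_exp_mul_div_pow {u v s : ℝ} {m : ℕ} (hv : 0 < v) (hu : 0 < u)
    (h : s ≤ m * ((u - v) / u)) : 1 ≤ Real.exp (-s) * (u / v) ^ m := by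
  have h1 : v / u ≤ Real.exp (-((u - v) / u)) := by
    have := Real.add_one_le_exp (-((u - v) / u))
    have h2 : -((u - v) / u) + 1 = v / u := by field_simp; ring
    linarith
  have h2 : Real.exp ((u - v) / u) ≤ u / v := by
    rw [← neg_neg ((u - v) / u), Real.exp_neg, ← inv_div v u]
    exact inv_anti₀ (div_pos hv hu) h1
  calc (1 : ℝ) = Real.exp (-s) * Real.exp s := by rw [← Real.exp_add]; simp
    _ ≤ Real.exp (-s) * Real.exp (m * ((u - v) / u)) := by gcongr
    _ = Real.exp (-s) * Real.exp ((u - v) / u) ^ m := by rw [Real.exp_nat_mul]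
    _ ≤ _ := by gcongr

lemma measure_block_upcross_le {Ω : Type*} [MeasurableSpace Ω] {P : Measure Ω}
    {X : ℕ → Ω → ℕ} {p : ℕ → ℝ} (hX : IsNNWalk P X p 0) (hE0 : ∀ i, 0 < E p i)
    (hE1 : ∀ i, E p i ≤ 1) {B : ℝ} {i₀ : ℕ} (hB : 1 < B) (hi : B < 2 * i₀)
    (hE : ∀ i, i₀ ≤ i → E p i = 1 / 2 + B / (4 * (i : ℝ))) {K : ℕ} (hK : 2 * B ≤ K)
    {ε : ℝ} (hε : 0 < ε) (hε1 : ε ≤ 1) {a : ℕ} (ha : i₀ ≤ a) (haB : 4 * B ≤ ε * a)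
    (hlog : 0 ≤ Real.log (Real.log a)) (hloga : 0 < Real.log a) :
    P {ω | ∃ R, a ≤ R ∧ R < 2 * a ∧
        ENNReal.ofReal ((1 + ε) * R * Real.log (Real.log R) / (B - 1)) < upcross X R ω} ≤
      ENNReal.ofReal (Real.exp (-((1 + ε / 4) * Real.log (Real.log a))) *
        ((1 + ε / 8 / 2 ^ K) / (ε / 8 / 2 ^ K))) := by
  set η : ℝ := ε / 8 / 2 ^ K with hη
  have hη0 : 0 < η := by positivity
  have hη2 : η * 2 ^ K = ε / 8 := by rw [hη]; field_simp
  have hGa := harm_pos hB hi a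
  have haB' : B ≤ a := by nlinarith [(Nat.cast_nonneg a : (0 : ℝ) ≤ a)]
  have h := measure_exists_le_upcross hX hE0 hE1 (a := a) (b := 2 * a)
    (l := fun R => (1 + ε) * R * Real.log (Real.log R) / (B - 1))
    (y := fun R => harm B i₀ R + η * harm B i₀ a)
    (c := Real.exp (-((1 + ε / 4) * Real.log (Real.log a)))) (y₀ := η * harm B i₀ a)
    (Real.exp_pos _).le (by positivity)
    (fun R _ => by have := harm_pos hB hi R; linarith)
    (fun R hR => by have := harm_antitone_step hB hi (ha.trans hR); linarith)
    (fun R hR => by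
      have := harm_harmonic hB hE (ha.trans hR)
      simpa only [add_sub_add_right_eq_sub] using this) ?_
  · refine h.trans (le_of_eq ?_)
    congr 2
    field_simp
  · intro R m haR hR2 hm
    have hG := harm_pos hB hi R
    have hG' := harm_pos hB hi (R + 1)
    refine one_le_exp_mul_div_pow (by positivity) (by positivity) ?_
    rw [add_sub_add_right_eq_sub, harm_sub hB (ha.trans haR)]
    have haR' : (a : ℝ) ≤ R := by exact_mod_cast haR
    have hR0 : 0 < (R : ℝ) := by linarith
    have hB1 : 0 < B - 1 := by linarith
    have hle := harm_le_two_pow_mul hB hi hK ha haB' haR hR2.le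
    have h1 : harm B i₀ R + η * harm B i₀ a ≤ harm B i₀ R * (1 + ε / 8) := by
      have := mul_le_mul_of_nonneg_left hle hη0.le
      rw [← mul_assoc, hη2] at this
      linarith
    have h2 : (R : ℝ) + B / 2 ≤ R * (1 + ε / 8) := by nlinarith
    have hll : Real.log (Real.log a) ≤ Real.log (Real.log R) :=
      Real.log_le_log hloga (Real.log_le_log (by linarith) haR')
    have h3 : (B - 1) / (R * (1 + ε / 8) * (1 + ε / 8)) ≤
        harm B i₀ R * ((B - 1) / (R + B / 2)) / (harm B i₀ R + η * harm B i₀ a) := by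
      rw [le_div_iff₀ (by positivity), mul_div_assoc', le_div_iff₀ (by positivity),
        div_mul_eq_mul_div, div_mul_eq_mul_div, div_le_iff₀ (by positivity)]
      calc (B - 1) * (harm B i₀ R + η * harm B i₀ a) * (R + B / 2) ≤
          (B - 1) * (harm B i₀ R * (1 + ε / 8)) * (R * (1 + ε / 8)) := by gcongr
        _ = _ := by ring
    have h4 : (1 + ε / 4) * ((1 + ε / 8) * (1 + ε / 8)) ≤ 1 + ε := by
      have h5 : ε ^ 2 ≤ ε := by nlinarith
      have h6 : ε ^ 3 ≤ ε := by nlinarith [mul_le_mul_of_nonneg_left h5 hε.le]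
      nlinarith
    calc (1 + ε / 4) * Real.log (Real.log a)
        ≤ (1 + ε) * R * Real.log (Real.log R) / (B - 1) *
          ((B - 1) / (R * (1 + ε / 8) * (1 + ε / 8))) := by
          have : (1 + ε) * R * Real.log (Real.log R) / (B - 1) *
              ((B - 1) / (R * (1 + ε / 8) * (1 + ε / 8))) =
              (1 + ε) * Real.log (Real.log R) / ((1 + ε / 8) * (1 + ε / 8)) := by
            field_simp
          rw [this, le_div_iff₀ (by positivity)]
          calc _ = (1 + ε / 4) * ((1 + ε / 8) * (1 + ε / 8)) * Real.log (Real.log a) := by ring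
            _ ≤ _ := by gcongr
      _ ≤ m * ((B - 1) / (R * (1 + ε / 8) * (1 + ε / 8))) := by gcongr
      _ ≤ _ := by gcongr

theorem ae_eventually_upcross_le {Ω : Type*} [MeasurableSpace Ω] {P : Measure Ω}
    {X : ℕ → Ω → ℕ} {p : ℕ → ℝ} (hX : IsNNWalk P X p 0) (hE0 : ∀ i, 0 < E p i)
    (hE1 : ∀ i, E p i ≤ 1) {B : ℝ} {i₀ : ℕ} (hB : 1 < B) (hi : B < 2 * i₀)
    (hE : ∀ i, i₀ ≤ i → E p i = 1 / 2 + B / (4 * (i : ℝ)))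
    {ε : ℝ} (hε : 0 < ε) (hε1 : ε ≤ 1) :
    ∀ᵐ ω ∂P, ∀ᶠ R : ℕ in atTop,
      upcross X R ω ≤ ENNReal.ofReal ((1 + ε) * R * Real.log (Real.log R) / (B - 1)) := by
  obtain ⟨K, hK⟩ := exists_nat_ge (2 * B)
  obtain ⟨N, hN⟩ := exists_nat_ge (4 * B / ε)
  rw [div_le_iff₀ hε] at hN
  set k₀ := i₀ + N + 4 with hk₀
  set C := (1 + ε / 8 / 2 ^ K) / (ε / 8 / 2 ^ K) with hC
  set S : ℕ → Set Ω := fun k => {ω | ∃ R : ℕ, 2 ^ k ≤ R ∧ R < 2 * 2 ^ k ∧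
    ENNReal.ofReal ((1 + ε) * R * Real.log (Real.log R) / (B - 1)) < upcross X R ω} with hS
  have hl2 : (1 : ℝ) / 2 < Real.log 2 := by have := Real.log_two_gt_d9; linarith
  have hlogk : ∀ k : ℕ, Real.log ((2 ^ k : ℕ) : ℝ) = k * Real.log 2 := by
    intro k; push_cast; rw [Real.log_pow]
  have hbd : ∀ k, P (S (k + k₀)) ≤ ENNReal.ofReal
      (((k + k₀ : ℕ) : ℝ) ^ (-(1 + ε / 4)) * ((Real.log 2) ^ (-(1 + ε / 4)) * C)) := by
    intro k
    set k' := k + k₀ with hk'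
    have hpow : k' < 2 ^ k' := Nat.lt_two_pow_self
    have hNk : (N : ℝ) ≤ ((2 ^ k' : ℕ) : ℝ) := by
      exact_mod_cast (by omega : N ≤ k').trans hpow.le
    have hk4 : (4 : ℝ) ≤ k' := by exact_mod_cast (by omega : 4 ≤ k')
    have h1 : 1 ≤ (k' : ℝ) * Real.log 2 := by nlinarith
    refine (measure_block_upcross_le hX hE0 hE1 hB hi hE hK hε hε1 (a := 2 ^ k')
      (by omega) (by nlinarith) ?_ ?_).trans (le_of_eq ?_)
    · rw [hlogk]; exact Real.log_nonneg h1
    · rw [hlogk]; linarith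
    · congr 1
      rw [hlogk, ← mul_assoc, ← Real.mul_rpow (by positivity) (by positivity),
        Real.rpow_def_of_pos (by linarith)]
      congr 2
      ring
  have hsum : ∑' k, P (S (k + k₀)) ≠ ∞ := by
    refine ne_top_of_le_ne_top ?_ (ENNReal.tsum_le_tsum hbd)
    refine Summable.tsum_ofReal_ne_top (Summable.mul_right _ ?_)
    refine (summable_nat_add_iff (f := fun k : ℕ => (k : ℝ) ^ (-(1 + ε / 4))) k₀).2 ?_
    exact Real.summable_nat_rpow.2 (by linarith)
  filter_upwards [ae_eventually_notMem hsum] with ω hω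
  obtain ⟨k₁, hk₁⟩ := eventually_atTop.1 hω
  refine eventually_atTop.2 ⟨2 ^ (k₁ + k₀), fun R hR => ?_⟩
  have hR0 : R ≠ 0 := by have : 0 < 2 ^ (k₁ + k₀) := by positivity
                         omega
  have hlk : k₁ + k₀ ≤ Nat.log 2 R := (Nat.le_log_iff_pow_le (by norm_num) hR0).2 hR
  have := hk₁ (Nat.log 2 R - k₀) (by omega)
  rw [Nat.sub_add_cancel (by omega)] at this
  by_contra hcon
  refine this ⟨R, Nat.pow_log_le_self 2 hR0, ?_, not_le.1 hcon⟩
  have := Nat.lt_pow_succ_log_self (b := 2) (by norm_num) R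
  rw [pow_succ] at this
  omega

section Levels

/-- The state is the number of levels `r 1, r 2, …` reached so far, together with the number of
visits to the current level that are still needed for a total of `m` visits (`0` is absorbing). -/
def levelNext (r m : ℕ → ℕ) (_ y : ℕ) (t : ℕ × ℕ) : ℕ × ℕ :=
  if y = r (t.1 + 1) then (t.1 + 1, if t.2 = 0 then 0 else m (t.1 + 1) - 1)
  else if t.1 ≠ 0 ∧ y = r t.1 then (t.1, t.2 - 1) else t

/-- A lower bound for the return probability to the level `r κ`, if `g κ` is a lower bound for
the probability of hitting it. -/
def retProb (p : ℕ → ℝ) (r : ℕ → ℕ) (g : ℕ → ℕ → ℝ) (κ : ℕ) : ℝ :=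
  E p (r κ) * g κ (r κ + 1) + (1 - E p (r κ)) * g κ (r κ - 1)

/-- The value function bounding the probability that none of the levels `r 1, …, r K` is visited
often. -/
def levelValue (p : ℕ → ℝ) (r m : ℕ → ℕ) (g : ℕ → ℕ → ℝ) (K x : ℕ) (t : ℕ × ℕ) : ℝ :=
  if t.2 = 0 then 0 else
    (1 - (if t.1 ≠ 0 ∧ t.1 ≤ K then
        (if x = r t.1 then retProb p r g t.1 else g t.1 x) * retProb p r g t.1 ^ (t.2 - 1)
      else 0)) * ∏ j ∈ Finset.Ico (t.1 + 1) (K + 1), (1 - retProb p r g j ^ (m j - 1))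

variable {p : ℕ → ℝ} {r m : ℕ → ℕ} {g : ℕ → ℕ → ℝ}

lemma retProb_nonneg (hE0 : ∀ i, 0 ≤ E p i) (hE1 : ∀ i, E p i ≤ 1) (hg0 : ∀ κ x, 0 ≤ g κ x)
    (κ : ℕ) : 0 ≤ retProb p r g κ :=
  add_nonneg (mul_nonneg (hE0 _) (hg0 _ _)) (mul_nonneg (sub_nonneg.2 (hE1 _)) (hg0 _ _))

lemma retProb_le_one (hE0 : ∀ i, 0 ≤ E p i) (hE1 : ∀ i, E p i ≤ 1) (hg1 : ∀ κ x, g κ x ≤ 1)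
    (κ : ℕ) : retProb p r g κ ≤ 1 := by
  have h1 := mul_le_mul_of_nonneg_left (hg1 κ (r κ + 1)) (hE0 (r κ))
  have h2 := mul_le_mul_of_nonneg_left (hg1 κ (r κ - 1)) (sub_nonneg.2 (hE1 (r κ)))
  unfold retProb
  linarith

lemma one_sub_retProb_pow_nonneg (hE0 : ∀ i, 0 ≤ E p i) (hE1 : ∀ i, E p i ≤ 1)
    (hg0 : ∀ κ x, 0 ≤ g κ x) (hg1 : ∀ κ x, g κ x ≤ 1) (κ n : ℕ) :
    0 ≤ 1 - retProb p r g κ ^ n :=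
  sub_nonneg.2 (pow_le_one₀ (retProb_nonneg hE0 hE1 hg0 κ) (retProb_le_one hE0 hE1 hg1 κ))

lemma levelValue_nonneg (hE0 : ∀ i, 0 ≤ E p i) (hE1 : ∀ i, E p i ≤ 1)
    (hg0 : ∀ κ x, 0 ≤ g κ x) (hg1 : ∀ κ x, g κ x ≤ 1) (K x : ℕ) (t : ℕ × ℕ) :
    0 ≤ levelValue p r m g K x t := by
  have hρ1 := retProb_le_one (r := r) hE0 hE1 hg1
  have hρ0 := retProb_nonneg (r := r) hE0 hE1 hg0
  unfold levelValue
  split_ifs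
  · exact le_rfl
  all_goals
    refine mul_nonneg (sub_nonneg.2 ?_) (Finset.prod_nonneg fun j _ =>
      one_sub_retProb_pow_nonneg hE0 hE1 hg0 hg1 _ _)
  · exact mul_le_one₀ (hρ1 _) (pow_nonneg (hρ0 _) _) (pow_le_one₀ (hρ0 _) (hρ1 _))
  · exact mul_le_one₀ (hg1 _ _) (pow_nonneg (hρ0 _) _) (pow_le_one₀ (hρ0 _) (hρ1 _))
  · exact zero_le_one

/-- The value after a step to `y`, in terms of `g`. -/
lemma levelValue_next_le (hE0 : ∀ i, 0 ≤ E p i) (hE1 : ∀ i, E p i ≤ 1)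
    (hg0 : ∀ κ x, 0 ≤ g κ x) (hg1 : ∀ κ x, g κ x ≤ 1) (hr : StrictMono r) (hm : ∀ j, 2 ≤ m j)
    (hgr : ∀ κ, g κ (r κ) = 1) (hgt : ∀ κ, g κ (r (κ + 1)) = 0) (K x y κ s : ℕ) :
    levelValue p r m g K y (levelNext r m x y (κ, s + 1)) ≤
      (1 - (if κ ≠ 0 ∧ κ ≤ K then g κ y * retProb p r g κ ^ s else 0)) *
        ∏ j ∈ Finset.Ico (κ + 1) (K + 1), (1 - retProb p r g j ^ (m j - 1)) := by
  have hm1 := hm (κ + 1)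
  have hpi : 0 ≤ ∏ j ∈ Finset.Ico (κ + 1) (K + 1), (1 - retProb p r g j ^ (m j - 1)) :=
    Finset.prod_nonneg fun j _ => one_sub_retProb_pow_nonneg hE0 hE1 hg0 hg1 _ _
  by_cases hy : y = r (κ + 1)
  · have h1 : m (κ + 1) - 1 ≠ 0 := by omega
    have h2 : (if κ ≠ 0 ∧ κ ≤ K then g κ y * retProb p r g κ ^ s else 0) = 0 := by
      rw [hy, hgt]; simp
    rw [h2]
    by_cases hK : κ + 1 ≤ K
    · rw [Finset.prod_eq_prod_Ico_succ_bot (by omega : κ + 1 < K + 1)]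
      have h3 : retProb p r g (κ + 1) * retProb p r g (κ + 1) ^ (m (κ + 1) - 1 - 1) =
          retProb p r g (κ + 1) ^ (m (κ + 1) - 1) := by
        rw [← pow_succ']; congr 1; omega
      simp [levelValue, levelNext, hy, h1, hK, h3]
    · have h4 : Finset.Ico (κ + 1) (K + 1) = ∅ := Finset.Ico_eq_empty (by omega)
      have h5 : Finset.Ico (κ + 1 + 1) (K + 1) = ∅ := Finset.Ico_eq_empty (by omega)
      simp [levelValue, levelNext, hy, h1, hK, h4, h5]
  · by_cases hκ : κ ≠ 0 ∧ y = r κ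
    · have hne : r κ ≠ r (κ + 1) := (hr (Nat.lt_succ_self κ)).ne
      obtain ⟨h0, rfl⟩ := hκ
      have hnxt : levelNext r m x (r κ) (κ, s + 1) = (κ, s) := by
        simp [levelNext, hne, h0]
      rw [hnxt]
      rcases Nat.eq_zero_or_pos s with rfl | hs
      · have hL : levelValue p r m g K (r κ) (κ, 0) = 0 := by simp [levelValue]
        rw [hL]
        refine mul_nonneg ?_ hpi
        split_ifs <;> simp [hgr]
      · have h3 : retProb p r g κ * retProb p r g κ ^ (s - 1) = retProb p r g κ ^ s := by
          rw [← pow_succ']; congr 1; omega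
        simp [levelValue, hs.ne', h3, hgr]
    · have hnxt : levelNext r m x y (κ, s + 1) = (κ, s + 1) := by
        simp [levelNext, hy, hκ]
      rw [hnxt]
      apply le_of_eq
      simp only [levelValue]
      by_cases h : κ ≠ 0 ∧ κ ≤ K
      · have hyr : y ≠ r κ := fun h' => hκ ⟨h.1, h'⟩
        simp [h, hyr]
      · simp only [if_neg h]; simp

/-- The value function is superharmonic. -/
lemma levelValue_step (hE0 : ∀ i, 0 ≤ E p i) (hE1 : ∀ i, E p i ≤ 1)
    (hg0 : ∀ κ x, 0 ≤ g κ x) (hg1 : ∀ κ x, g κ x ≤ 1) (hr : StrictMono r) (hm : ∀ j, 2 ≤ m j)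
    (hgr : ∀ κ, g κ (r κ) = 1) (hgt : ∀ κ, g κ (r (κ + 1)) = 0)
    (hg : ∀ κ x, x < r (κ + 1) → κ ≠ 0 → x ≠ r κ →
      g κ x ≤ E p x * g κ (x + 1) + (1 - E p x) * g κ (x - 1))
    (K x : ℕ) (t : ℕ × ℕ) (hx : x < r (t.1 + 1)) :
    E p x * levelValue p r m g K (x + 1) (levelNext r m x (x + 1) t) +
      (1 - E p x) * levelValue p r m g K (x - 1) (levelNext r m x (x - 1) t) ≤
      levelValue p r m g K x t := by
  obtain ⟨κ, s⟩ := t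
  rcases Nat.eq_zero_or_pos s with rfl | hs
  · have h0 : ∀ y, (levelNext r m x y (κ, 0)).2 = 0 := by
      intro y; unfold levelNext; split_ifs <;> simp_all
    simp [levelValue, h0]
  · obtain ⟨s, rfl⟩ : ∃ s', s = s' + 1 := ⟨s - 1, by omega⟩
    have h1 := mul_le_mul_of_nonneg_left
      (levelValue_next_le hE0 hE1 hg0 hg1 hr hm hgr hgt K x (x + 1) κ s) (hE0 x)
    have h2 := mul_le_mul_of_nonneg_left
      (levelValue_next_le hE0 hE1 hg0 hg1 hr hm hgr hgt K x (x - 1) κ s) (sub_nonneg.2 (hE1 x))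
    refine (add_le_add h1 h2).trans ?_
    have hpi : 0 ≤ ∏ j ∈ Finset.Ico (κ + 1) (K + 1), (1 - retProb p r g j ^ (m j - 1)) :=
      Finset.prod_nonneg fun j _ => one_sub_retProb_pow_nonneg hE0 hE1 hg0 hg1 _ _
    simp only [levelValue, Nat.add_sub_cancel, Nat.succ_ne_zero, if_false]
    rw [← mul_assoc, ← mul_assoc, ← add_mul]
    refine mul_le_mul_of_nonneg_right ?_ hpi
    by_cases h : κ ≠ 0 ∧ κ ≤ K
    · simp only [if_pos h]
      have hq : 0 ≤ retProb p r g κ ^ s := pow_nonneg (retProb_nonneg hE0 hE1 hg0 κ) _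
      have hle : (if x = r κ then retProb p r g κ else g κ x) ≤
          E p x * g κ (x + 1) + (1 - E p x) * g κ (x - 1) := by
        split_ifs with hxr
        · rw [hxr, retProb]
        · exact hg κ x hx h.1 hxr
      have := mul_le_mul_of_nonneg_right hle hq
      linarith
    · simp only [if_neg h]
      linarith

/-- Along a nearest neighbour path the walk has not reached the next level. -/
lemma lt_level {u : ℕ → ℕ} (hu : ∀ n, u (n + 1) = u n + 1 ∨ u (n + 1) + 1 = u n)
    (hr : StrictMono r) {t₀ : ℕ × ℕ} (h0 : u 0 < r (t₀.1 + 1)) (n : ℕ) :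
    u n < r ((stateOf (levelNext r m) t₀ u n).1 + 1) := by
  induction n with
  | zero => exact h0
  | succ n ih =>
    simp only [stateOf]
    set t := stateOf (levelNext r m) t₀ u n
    clear_value t
    have h2 : r (t.1 + 1) < r (t.1 + 1 + 1) := hr (Nat.lt_succ_self _)
    unfold levelNext
    have := hu n
    split_ifs <;> (try simp only) <;> omega

/-- Few visits to the levels keep the state alive. -/
lemma level_state_alive {u : ℕ → ℕ} (hm : ∀ j, 2 ≤ m j)
    (h : ∀ j n, j ≠ 0 → #{k ∈ Finset.range n | u k = r j} < m j) (n : ℕ) :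
    (stateOf (levelNext r m) (0, 1) u n).2 ≠ 0 ∧
      ((stateOf (levelNext r m) (0, 1) u n).1 ≠ 0 →
        m (stateOf (levelNext r m) (0, 1) u n).1 ≤ (stateOf (levelNext r m) (0, 1) u n).2 +
          #{k ∈ Finset.range (n + 1) | u k = r (stateOf (levelNext r m) (0, 1) u n).1}) := by
  induction n with
  | zero => simp [stateOf]
  | succ n ih =>
    rw [show stateOf (levelNext r m) (0, 1) u (n + 1) = levelNext r m (u n) (u (n + 1))
      (stateOf (levelNext r m) (0, 1) u n) from rfl]
    generalize stateOf (levelNext r m) (0, 1) u n = t at ih ⊢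
    have hcard : ∀ j, #{k ∈ Finset.range (n + 1 + 1) | u k = r j} =
        #{k ∈ Finset.range (n + 1) | u k = r j} + if u (n + 1) = r j then 1 else 0 := by
      intro j
      rw [Finset.range_add_one (n := n + 1), Finset.filter_insert]
      split_ifs
      · rw [Finset.card_insert_of_notMem (by simp)]
      · simp
    have h1 := hm (t.1 + 1)
    unfold levelNext
    split_ifs with hy hs hκ
    · exact absurd hs ih.1
    · simp only [hcard, if_pos hy]
      exact ⟨by omega, fun _ => by omega⟩
    · simp only [hcard, if_pos hκ.2]
      have h3 := h t.1 (n + 1 + 1) hκ.1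
      rw [hcard, if_pos hκ.2] at h3
      have h4 := ih.2 hκ.1
      have h5 := ih.1
      exact ⟨by omega, fun _ => by omega⟩
    · refine ⟨ih.1, fun h0 => ?_⟩
      have := ih.2 h0
      rw [hcard]
      omega

/-- The probability that each of the levels `r 1, r 2, …` is visited less than `m` times. -/
theorem measure_forall_localTime_lt {Ω : Type*} [MeasurableSpace Ω] {P : Measure Ω}
    {X : ℕ → Ω → ℕ} (hX : IsNNWalk P X p 0) (hE : E p 0 = 1)
    (hE0 : ∀ i, 1 / 2 ≤ E p i) (hE1 : ∀ i, E p i ≤ 1)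
    (hg0 : ∀ κ x, 0 ≤ g κ x) (hg1 : ∀ κ x, g κ x ≤ 1) (hr : StrictMono r) (hm : ∀ j, 2 ≤ m j)
    (hgr : ∀ κ, g κ (r κ) = 1) (hgt : ∀ κ, g κ (r (κ + 1)) = 0)
    (hg : ∀ κ x, x < r (κ + 1) → κ ≠ 0 → x ≠ r κ →
      g κ x ≤ E p x * g κ (x + 1) + (1 - E p x) * g κ (x - 1)) (K : ℕ) :
    P {ω | ∀ j, j ≠ 0 → localTime X (r j) ω < m j} ≤
      ENNReal.ofReal (∏ j ∈ Finset.Ico 1 (K + 1), (1 - retProb p r g j ^ (m j - 1))) := by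
  have hE0' : ∀ i, 0 ≤ E p i := fun i => le_trans (by norm_num) (hE0 i)
  have hr1 : 0 < r 1 := (Nat.zero_le _).trans_lt (hr Nat.zero_lt_one)
  set S : ℕ → Set Ω := fun n =>
    {ω | (stateOf (levelNext r m) (0, 1) (fun k => X k ω) n).2 ≠ 0 ∧
      K + 1 ≤ (stateOf (levelNext r m) (0, 1) (fun k => X k ω) n).1} with hSdef
  have hSn : ∀ n, P (S n) ≤ ENNReal.ofReal
      (∏ j ∈ Finset.Ico 1 (K + 1), (1 - retProb p r g j ^ (m j - 1))) := by
    intro n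
    have h := measure_le_of_superharmonic hX hE0' hE1 (levelNext r m) (0, 1)
      (fun _ x t => ENNReal.ofReal (levelValue p r m g K x t))
      (fun _ x t => x < r (t.1 + 1)) (fun _ t => t.2 ≠ 0 ∧ K + 1 ≤ t.1) ?_ ?_ ?_ ?_ n hr1
    · refine h.trans (le_of_eq ?_)
      simp [levelValue]
    · intro k x t hx
      have h2 : r (t.1 + 1) < r (t.1 + 1 + 1) := hr (Nat.lt_succ_self _)
      unfold levelNext
      split_ifs <;> (try simp only) <;> omega
    · intro k x t hx
      have h2 : r (t.1 + 1) < r (t.1 + 1 + 1) := hr (Nat.lt_succ_self _)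
      unfold levelNext
      split_ifs <;> (try simp only) <;> omega
    · intro k x t hx
      rw [ofReal_convex_comb (hE0' x) (hE1 x) (levelValue_nonneg hE0' hE1 hg0 hg1 _ _ _)
        (levelValue_nonneg hE0' hE1 hg0 hg1 _ _ _)]
      exact ENNReal.ofReal_le_ofReal
        (levelValue_step hE0' hE1 hg0 hg1 hr hm hgr hgt hg K x t hx)
    · rintro x t hx ⟨hs, hK⟩
      have h5 : Finset.Ico (t.1 + 1) (K + 1) = ∅ := Finset.Ico_eq_empty (by omega)
      have h6 : ¬ t.1 ≤ K := by omega
      simp [levelValue, hs, h5, h6]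
  have hmono : Monotone fun N => ⋂ n, ⋂ (_ : N ≤ n), S n := fun N N' h ω hω => by
    simp only [Set.mem_iInter] at hω ⊢
    exact fun n hn => hω n (h.trans hn)
  have hsub : ∀ᵐ ω ∂P, ω ∈ {ω | ∀ j, j ≠ 0 → localTime X (r j) ω < m j} → ω ∈ ⋃ N, ⋂ n, ⋂ (_ : N ≤ n), S n := by
    filter_upwards [ae_nearest_neighbour hX hE0' hE1 hE, ae_exists_le hX hE0 hE1 hE]
      with ω hnn hinf hω
    obtain ⟨n, hn⟩ := hinf (r (K + 1))
    have hκ : Monotone fun n => (stateOf (levelNext r m) (0, 1) (fun k => X k ω) n).1 := by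
      refine monotone_nat_of_le_succ fun n => ?_
      simp only [stateOf]
      set t := stateOf (levelNext r m) (0, 1) (fun k => X k ω) n
      clear_value t
      unfold levelNext
      split_ifs <;> omega
    refine Set.mem_iUnion.2 ⟨n, Set.mem_iInter₂.2 fun n' hn' =>
      ⟨(level_state_alive hm (fun j n hj => ?_) n').1, le_trans ?_ (hκ hn')⟩⟩
    · have h := hω j hj
      rw [← Nat.cast_lt (α := ℝ≥0∞)]
      refine lt_of_le_of_lt ?_ h
      rw [localTime, ENNReal.tsum_eq_iSup_nat]
      refine le_iSup_of_le n (le_of_eq ?_)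
      rw [Finset.card_filter]
      push_cast
      exact Finset.sum_congr rfl fun k _ => by simp [Set.indicator_apply]
    · by_contra hcon
      have h1 := lt_level (u := fun k => X k ω) hnn hr (m := m) (t₀ := (0, 1))
        (by simpa [hX.1 ω] using hr1) n
      have h2 := hr.monotone (not_le.1 hcon)
      simp only [Nat.succ_eq_add_one] at h1 h2
      omega
  calc _ ≤ P (⋃ N, ⋂ n, ⋂ (_ : N ≤ n), S n) := measure_mono_ae hsub
    _ = ⨆ N, P (⋂ n, ⋂ (_ : N ≤ n), S n) := hmono.measure_iUnion
    _ ≤ _ := iSup_le fun N => (measure_mono (Set.iInter₂_subset N le_rfl)).trans (hSn N)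

end Levels

/-- The probability of hitting `r` before leaving `(l, t)`, for a scale function `G`. -/
def hitFun (G : ℕ → ℝ) (l r t x : ℕ) : ℝ :=
  if x ≤ l ∨ t ≤ x then 0 else if x ≤ r then (G l - G x) / (G l - G r)
  else (G x - G t) / (G r - G t)

section HitFun

variable {G : ℕ → ℝ} {l r t : ℕ}

lemma hitFun_of_le (hlr : l < r) (hrt : r < t) {x : ℕ} (hlx : l ≤ x) (hxr : x ≤ r) :
    hitFun G l r t x = (G l - G x) / (G l - G r) := by
  unfold hitFun
  split_ifs with h
  · obtain rfl : x = l := by omega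
    simp
  · rfl

lemma hitFun_of_ge (hlr : l < r) (hrt : r < t) (hG : G r ≠ G t) (hG' : G l ≠ G r) {x : ℕ}
    (hrx : r ≤ x) (hxt : x ≤ t) : hitFun G l r t x = (G x - G t) / (G r - G t) := by
  unfold hitFun
  split_ifs with h h2
  · obtain rfl : x = t := by omega
    simp
  · obtain rfl : x = r := by omega
    rw [div_self (sub_ne_zero.2 hG), div_self (sub_ne_zero.2 hG')]
  · rfl

lemma hitFun_mem_Icc (hG : ∀ x y, l ≤ x → x ≤ y → G y ≤ G x) (hlr : l < r) (hrt : r < t)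
    (x : ℕ) : hitFun G l r t x ∈ Set.Icc (0 : ℝ) 1 := by
  have h1 := hG l r le_rfl hlr.le
  have h2 := hG r t hlr.le hrt.le
  unfold hitFun
  split_ifs with h h3
  · simp
  · have h4 := hG l x le_rfl (by omega)
    have h5 := hG x r (by omega) h3
    exact ⟨div_nonneg (by linarith) (by linarith), div_le_one_of_le₀ (by linarith) (by linarith)⟩
  · have h4 := hG r x hlr.le (by omega)
    have h5 := hG x t (by omega) (by omega)
    exact ⟨div_nonneg (by linarith) (by linarith), div_le_one_of_le₀ (by linarith) (by linarith)⟩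

lemma hitFun_subharmonic {e : ℕ → ℝ} (he0 : ∀ i, 0 ≤ e i) (he1 : ∀ i, e i ≤ 1)
    (hG : ∀ x y, l ≤ x → x ≤ y → G y ≤ G x) (hlr : l < r) (hrt : r < t)
    (hGr : G r ≠ G t) (hGl : G l ≠ G r)
    (hharm : ∀ x, l ≤ x → (1 - e (x + 1)) * (G x - G (x + 1)) =
      e (x + 1) * (G (x + 1) - G (x + 2))) {x : ℕ} (hx : x ≠ r) :
    hitFun G l r t x ≤
      e x * hitFun G l r t (x + 1) + (1 - e x) * hitFun G l r t (x - 1) := by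
  have hnn := fun y => (hitFun_mem_Icc hG hlr hrt y).1
  by_cases h : x ≤ l ∨ t ≤ x
  · have : hitFun G l r t x = 0 := by simp [hitFun, h]
    rw [this]
    exact add_nonneg (mul_nonneg (he0 x) (hnn _)) (mul_nonneg (sub_nonneg.2 (he1 x)) (hnn _))
  · obtain ⟨y, rfl⟩ : ∃ y, x = y + 1 := ⟨x - 1, by omega⟩
    have hh := hharm y (by omega)
    rw [Nat.add_sub_cancel]
    apply le_of_eq
    rcases Nat.lt_or_ge (y + 1) r with hr | hr
    · rw [hitFun_of_le hlr hrt (by omega) (by omega), hitFun_of_le hlr hrt (by omega) (by omega),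
        hitFun_of_le hlr hrt (by omega) (by omega), ← mul_div_assoc, ← mul_div_assoc, ← add_div]
      congr 1
      linarith
    · rw [hitFun_of_ge hlr hrt hGr hGl (by omega) (by omega),
        hitFun_of_ge hlr hrt hGr hGl (by omega) (by omega),
        hitFun_of_ge hlr hrt hGr hGl (by omega) (by omega),
        ← mul_div_assoc, ← mul_div_assoc, ← add_div]
      congr 1
      linarith

end HitFun

lemma harm_strictAnti {B : ℝ} {i₀ : ℕ} (hB : 1 < B) (hi : B < 2 * i₀) {x y : ℕ} (hx : i₀ ≤ x)
    (hxy : x < y) : harm B i₀ y < harm B i₀ x := by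
  refine (harm_anti hB hi (by omega) (Nat.succ_le_of_lt hxy)).trans_lt ?_
  have h := harm_sub (i₀ := i₀) hB hx
  have : 0 < harm B i₀ x * ((B - 1) / (x + B / 2)) :=
    mul_pos (harm_pos hB hi x) (div_pos (by linarith) (by positivity))
  rw [Nat.succ_eq_add_one]
  linarith

/-- The escape probability from a site whose neighbouring levels are far away. -/
lemma escape_hitFun_le {p : ℕ → ℝ} {B : ℝ} {i₀ : ℕ} (hB : 1 < B) (hi : B < 2 * i₀)
    (hE : ∀ i, i₀ ≤ i → E p i = 1 / 2 + B / (4 * (i : ℝ))) {l r t : ℕ} (hl : i₀ ≤ l)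
    (hlr : l < r) (hrt : r < t) {A δ : ℝ} (hA : 2 + δ ≤ δ * A) (hδ : 0 < δ)
    (h1 : harm B i₀ r * A ≤ harm B i₀ l) (h2 : harm B i₀ t * A ≤ harm B i₀ r) :
    1 - (E p r * hitFun (harm B i₀) l r t (r + 1) +
      (1 - E p r) * hitFun (harm B i₀) l r t (r - 1)) ≤ (B - 1) * (1 + δ) / (2 * r) := by
  have hA1 : 1 < A := by nlinarith
  have hGl := harm_strictAnti hB hi hl hlr
  have hGr := harm_strictAnti hB hi (hl.trans hlr.le) hrt
  obtain ⟨y, rfl⟩ : ∃ y, r = y + 1 := ⟨r - 1, by omega⟩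
  have hharm := harm_harmonic hB hE (x := y) (by omega)
  have hsub := harm_sub (i₀ := i₀) hB (x := y + 1) (by omega)
  have hG := harm_pos hB hi (y + 1)
  rw [Nat.add_sub_cancel, hitFun_of_ge hlr hrt hGr.ne' hGl.ne' (by omega) (by omega),
    hitFun_of_le hlr hrt (by omega) (by omega)]
  set G := harm B i₀
  have hr0 : (0 : ℝ) < ((y + 1 : ℕ) : ℝ) := by positivity
  have hD1 : 0 < G (y + 1) - G t := by linarith
  have hD2 : 0 < G l - G (y + 1) := by linarith
  have hEr : E p (y + 1) * (G (y + 1) - G (y + 2)) =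
      G (y + 1) * ((B - 1) / (2 * ((y + 1 : ℕ) : ℝ))) := by
    rw [hsub, hE (y + 1) (by omega)]
    have : 0 < ((y + 1 : ℕ) : ℝ) + B / 2 := by positivity
    field_simp
    ring
  have hB1 : 0 < B - 1 := by linarith
  have hq : 0 ≤ (B - 1) / (2 * ((y + 1 : ℕ) : ℝ)) := by positivity
  have heq : 1 - (E p (y + 1) * ((G (y + 1 + 1) - G t) / (G (y + 1) - G t)) +
      (1 - E p (y + 1)) * ((G l - G y) / (G l - G (y + 1)))) =
      (B - 1) / (2 * ((y + 1 : ℕ) : ℝ)) *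
        (G (y + 1) / (G (y + 1) - G t) + G (y + 1) / (G l - G (y + 1))) := by
    have e1 : (G (y + 1 + 1) - G t) / (G (y + 1) - G t) =
        1 - (G (y + 1) - G (y + 2)) / (G (y + 1) - G t) := by
      field_simp; ring
    have e2 : (G l - G y) / (G l - G (y + 1)) =
        1 - (G y - G (y + 1)) / (G l - G (y + 1)) := by
      field_simp; ring
    rw [e1, e2]
    calc _ = E p (y + 1) * (G (y + 1) - G (y + 2)) / (G (y + 1) - G t) +
          (1 - E p (y + 1)) * (G y - G (y + 1)) / (G l - G (y + 1)) := by ring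
      _ = _ := by rw [hharm, hEr]; ring
  rw [heq]
  have h3 : G (y + 1) / (G (y + 1) - G t) ≤ A / (A - 1) := by
    rw [div_le_div_iff₀ hD1 (by linarith)]
    linarith
  have h4 : G (y + 1) / (G l - G (y + 1)) ≤ 1 / (A - 1) := by
    rw [div_le_div_iff₀ hD2 (by linarith)]
    linarith
  have h5 : A / (A - 1) + 1 / (A - 1) ≤ 1 + δ := by
    rw [← add_div, div_le_iff₀ (by linarith)]
    linarith
  calc _ ≤ (B - 1) / (2 * ((y + 1 : ℕ) : ℝ)) * (1 + δ) :=
        mul_le_mul_of_nonneg_left (by linarith) hq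
    _ = _ := by ring

lemma exp_neg_le_pow {ρ q δ s : ℝ} {n : ℕ} (hρ : 1 - ρ ≤ q) (hq0 : 0 ≤ q) (hδ : 0 < δ)
    (hq : q * (1 + δ) ≤ δ) (hn : n * (q * (1 + δ)) ≤ s) : Real.exp (-s) ≤ ρ ^ n := by
  have h1 : Real.exp (-(q * (1 + δ))) ≤ ρ := by
    have hpos : 0 < 1 + q * (1 + δ) := by positivity
    have h2 := Real.add_one_le_exp (q * (1 + δ))
    rw [Real.exp_neg]
    refine (inv_anti₀ hpos (by linarith)).trans ?_
    rw [inv_le_iff_one_le_mul₀ hpos]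
    nlinarith
  calc Real.exp (-s) ≤ Real.exp (n * (-(q * (1 + δ)))) := by gcongr; linarith
    _ = Real.exp (-(q * (1 + δ))) ^ n := Real.exp_nat_mul _ _
    _ ≤ ρ ^ n := by gcongr

section LowerBound

variable {Ω : Type*} [MeasurableSpace Ω] {P : Measure Ω} {X : ℕ → Ω → ℕ} {p : ℕ → ℝ}
  {B : ℝ} {i₀ : ℕ}

/-- The number of visits that is exceeded infinitely often. -/
def visitBound (B ε : ℝ) (R : ℕ) : ℝ := (1 - ε) * (2 * R * Real.log (Real.log R)) / (B - 1)

lemma tendsto_log_log_natCast : Tendsto (fun R : ℕ => Real.log (Real.log R)) atTop atTop :=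
  Real.tendsto_log_atTop.comp (Real.tendsto_log_atTop.comp tendsto_natCast_atTop_atTop)

lemma measure_visit_levels_eq_zero (hX : IsNNWalk P X p 0) (hE0 : ∀ i, 1 / 2 ≤ E p i)
    (hE1 : ∀ i, E p i ≤ 1) (hE00 : E p 0 = 1) (hB : 1 < B) (hi : B < 2 * i₀)
    (hE : ∀ i, i₀ ≤ i → E p i = 1 / 2 + B / (4 * (i : ℝ)))
    {ε A : ℝ} (hε : 0 < ε) (hε1 : ε < 1) (hA : 2 + ε / 2 ≤ ε / 2 * A) {J : ℕ}
    (hJ : A ≤ (1 + (B - 1) / 3) ^ J) {k₁ : ℕ} (hk₁ : i₀ ≤ k₁)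
    (hq : ∀ R : ℕ, k₁ ≤ R → (B - 1) * (1 + ε / 2) / (2 * R) * (1 + ε / 2) ≤ ε / 2)
    (hm : ∀ R : ℕ, k₁ ≤ R → 1 < visitBound B ε R)
    (hlog : ∀ R : ℕ, k₁ ≤ R → 0 ≤ Real.log (Real.log R) ∧ 0 < Real.log R) :
    P {ω | ∀ j, j ≠ 0 → localTime X ((2 ^ J) ^ (k₁ + j)) ω <
      (⌈visitBound B ε ((2 ^ J) ^ (k₁ + j))⌉₊ : ℝ≥0∞)} = 0 := by
  have hA1 : 1 < A := by nlinarith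
  have hJ0 : J ≠ 0 := by
    rintro rfl
    rw [pow_zero] at hJ
    linarith
  have hL : 1 < 2 ^ J := Nat.one_lt_two_pow hJ0
  set L : ℕ := 2 ^ J with hLdef
  set r : ℕ → ℕ := fun κ => L ^ (k₁ + κ) with hrdef
  have hr : StrictMono r := fun a b h => Nat.pow_lt_pow_right hL (by omega)
  set lo : ℕ → ℕ := fun κ => L ^ (k₁ + κ - 1) with hlodef
  have hi0 : 0 < i₀ := by
    rcases Nat.eq_zero_or_pos i₀ with rfl | h
    · norm_num at hi; linarith
    · exact h
  have hk0 : 0 < k₁ := by omega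
  have hlor : ∀ κ, lo κ < r κ := fun κ => Nat.pow_lt_pow_right hL (by omega)
  have hlo : ∀ κ, i₀ ≤ lo κ := by
    intro κ
    have := Nat.lt_pow_self hL (n := k₁ + κ - 1)
    simp only [hlodef]
    omega
  have hkr : ∀ κ, k₁ ≤ r κ := by
    intro κ
    have := Nat.lt_pow_self hL (n := k₁ + κ)
    simp only [hrdef]
    omega
  have hrsucc : ∀ κ, r (κ + 1) = L * r κ := fun κ => by
    simp only [hrdef]; rw [← pow_succ']; congr 1
  have hlosucc : ∀ κ, r κ = L * lo κ := fun κ => by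
    simp only [hrdef, hlodef]; rw [← pow_succ']; congr 1; omega
  set G := harm B i₀ with hGdef
  have hGanti : ∀ κ x y, lo κ ≤ x → x ≤ y → G y ≤ G x := fun κ x y hx hxy =>
    harm_anti hB hi ((hlo κ).trans hx) hxy
  have hdecay : ∀ x, i₀ ≤ x → G (L * x) * A ≤ G x := fun x hx =>
    (mul_le_mul_of_nonneg_left hJ (harm_pos hB hi _).le).trans (harm_two_pow_mul_le hB hi J hx)
  have hGr : ∀ κ, G (r κ) ≠ G (r (κ + 1)) := fun κ =>
    (harm_strictAnti hB hi ((hlo κ).trans (hlor κ).le) (hr (Nat.lt_succ_self κ))).ne'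
  have hGl : ∀ κ, G (lo κ) ≠ G (r κ) := fun κ => (harm_strictAnti hB hi (hlo κ) (hlor κ)).ne'
  set g : ℕ → ℕ → ℝ := fun κ x => hitFun G (lo κ) (r κ) (r (κ + 1)) x with hgdef
  have hrr : ∀ κ, r κ < r (κ + 1) := fun κ => hr (Nat.lt_succ_self κ)
  have hE0' : ∀ i, 0 ≤ E p i := fun i => le_trans (by norm_num) (hE0 i)
  set m : ℕ → ℕ := fun κ => ⌈visitBound B ε (r κ)⌉₊ with hmdef
  have hm2 : ∀ κ, 2 ≤ m κ := fun κ => Nat.lt_ceil.2 (by simpa using hm (r κ) (hkr κ))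
  have hB1 : 0 < B - 1 := by linarith
  have hret : ∀ κ, 1 / Real.log (r κ) ≤ retProb p r g κ ^ (m κ - 1) := by
    intro κ
    obtain ⟨hl0, hl1⟩ := hlog (r κ) (hkr κ)
    have hesc := escape_hitFun_le hB hi hE (hlo κ) (hlor κ) (hrr κ) (δ := ε / 2) hA (by linarith)
      (by have := hdecay (lo κ) (hlo κ); rwa [← hlosucc] at this)
      (by have := hdecay (r κ) ((hlo κ).trans (hlor κ).le); rwa [← hrsucc] at this)
    have hrpos : (0 : ℝ) < r κ := by exact_mod_cast (Nat.zero_le _).trans_lt (hlor κ)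
    have h := exp_neg_le_pow (s := Real.log (Real.log (r κ))) (n := m κ - 1) hesc
      (by positivity) (by linarith : 0 < ε / 2) (hq (r κ) (hkr κ)) ?_
    · rwa [Real.exp_neg, Real.exp_log hl1, ← one_div] at h
    · have h1 : ((m κ - 1 : ℕ) : ℝ) ≤ visitBound B ε (r κ) := by
        rw [Nat.cast_sub (by have := hm2 κ; omega)]
        have := Nat.ceil_lt_add_one (zero_le_one.trans (hm (r κ) (hkr κ)).le)
        push_cast
        linarith
      calc _ ≤ visitBound B ε (r κ) * ((B - 1) * (1 + ε / 2) / (2 * r κ) * (1 + ε / 2)) := by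
            gcongr
        _ = (1 - ε) * ((1 + ε / 2) * (1 + ε / 2)) * Real.log (Real.log (r κ)) := by
            unfold visitBound; field_simp
        _ ≤ 1 * Real.log (Real.log (r κ)) := by
            refine mul_le_mul_of_nonneg_right ?_ hl0
            nlinarith [sq_nonneg ε, mul_pos hε hε, mul_pos (mul_pos hε hε) hε]
        _ = _ := one_mul _
  have hlogr : ∀ κ, Real.log (r κ) = (k₁ + κ : ℕ) * Real.log L := by
    intro κ; simp only [hrdef]; push_cast; rw [Real.log_pow]; push_cast; rfl
  have hlogL : 0 < Real.log L := Real.log_pos (by exact_mod_cast hL)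
  have hmain := fun K => measure_forall_localTime_lt hX hE00 hE0 hE1
    (fun κ x => (hitFun_mem_Icc (hGanti κ) (hlor κ) (hrr κ) x).1)
    (fun κ x => (hitFun_mem_Icc (hGanti κ) (hlor κ) (hrr κ) x).2) hr hm2
    (g := g) (fun κ => by
      simp only [hgdef]
      rw [hitFun_of_le (hlor κ) (hrr κ) (hlor κ).le le_rfl, div_self (sub_ne_zero.2 (hGl κ))])
    (fun κ => by simp [hgdef, hitFun])
    (fun κ x _ _ hx => hitFun_subharmonic hE0' hE1 (hGanti κ) (hlor κ) (hrr κ) (hGr κ) (hGl κ)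
      (fun y hy => harm_harmonic hB hE ((hlo κ).trans hy)) hx) K
  have hprod : ∀ K, ∏ j ∈ Finset.Ico 1 (K + 1), (1 - retProb p r g j ^ (m j - 1)) ≤
      Real.exp (-((1 / Real.log L) *
        ∑ j ∈ Finset.Ico 1 (K + 1), 1 / ((k₁ + j : ℕ) : ℝ))) := by
    intro K
    rw [Finset.mul_sum, ← Finset.sum_neg_distrib, Real.exp_sum]
    refine Finset.prod_le_prod (fun j _ => one_sub_retProb_pow_nonneg hE0' hE1
      (fun κ x => (hitFun_mem_Icc (hGanti κ) (hlor κ) (hrr κ) x).1)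
      (fun κ x => (hitFun_mem_Icc (hGanti κ) (hlor κ) (hrr κ) x).2) _ _) fun j _ => ?_
    have h1 := hret j
    have h2 := Real.add_one_le_exp (-(1 / Real.log L * (1 / ((k₁ + j : ℕ) : ℝ))))
    have h3 : 1 / Real.log L * (1 / ((k₁ + j : ℕ) : ℝ)) = 1 / Real.log (r j) := by
      rw [hlogr, one_div_mul_one_div, mul_comm]
    linarith
  have hdiv : Tendsto (fun K : ℕ => ∑ j ∈ Finset.Ico 1 (K + 1), 1 / ((k₁ + j : ℕ) : ℝ))
      atTop atTop := by
    have h1 : ¬ Summable fun n : ℕ => 1 / ((n + (k₁ + 1) : ℕ) : ℝ) := fun h =>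
      Real.not_summable_one_div_natCast
        ((summable_nat_add_iff (f := fun n : ℕ => 1 / (n : ℝ)) (k₁ + 1)).1 h)
    have h2 := (not_summable_iff_tendsto_nat_atTop_of_nonneg (fun n => by positivity)).1 h1
    refine h2.congr fun K => ?_
    rw [Finset.sum_Ico_eq_sum_range, Nat.add_sub_cancel]
    refine Finset.sum_congr rfl fun j _ => ?_
    congr 2
    omega
  have hlim : Tendsto (fun K : ℕ => ENNReal.ofReal (Real.exp (-((1 / Real.log L) *
        ∑ j ∈ Finset.Ico 1 (K + 1), 1 / ((k₁ + j : ℕ) : ℝ))))) atTop (𝓝 0) := by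
    rw [← ENNReal.ofReal_zero]
    refine ENNReal.tendsto_ofReal (Real.tendsto_exp_neg_atTop_nhds_zero.comp ?_)
    exact hdiv.const_mul_atTop (by positivity)
  refine le_antisymm (ge_of_tendsto' hlim fun K => ?_) zero_le
  exact (hmain K).trans (ENNReal.ofReal_le_ofReal (hprod K))

theorem ae_frequently_le_localTime (hX : IsNNWalk P X p 0) (hE0 : ∀ i, 1 / 2 ≤ E p i)
    (hE1 : ∀ i, E p i ≤ 1) (hE00 : E p 0 = 1) (hB : 1 < B) (hi : B < 2 * i₀)
    (hE : ∀ i, i₀ ≤ i → E p i = 1 / 2 + B / (4 * (i : ℝ)))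
    {ε : ℝ} (hε : 0 < ε) (hε1 : ε < 1) :
    ∀ᵐ ω ∂P, ∃ᶠ R : ℕ in atTop, ENNReal.ofReal (visitBound B ε R) ≤ localTime X R ω := by
  have hB1 : 0 < B - 1 := by linarith
  have hb : 1 < 1 + (B - 1) / 3 := by linarith
  set A := (2 + ε / 2) / (ε / 2) with hAdef
  have hA : 2 + ε / 2 ≤ ε / 2 * A := by rw [hAdef]; field_simp; exact le_rfl
  obtain ⟨J, hJ⟩ := pow_unbounded_of_one_lt A hb
  have hlog1 : Tendsto (fun R : ℕ => Real.log R) atTop atTop :=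
    Real.tendsto_log_atTop.comp tendsto_natCast_atTop_atTop
  have hvis : Tendsto (fun R : ℕ => visitBound B ε R) atTop atTop := by
    have h : Tendsto (fun R : ℕ => (R : ℝ) * Real.log (Real.log R)) atTop atTop :=
      tendsto_natCast_atTop_atTop.atTop_mul_atTop₀ tendsto_log_log_natCast
    refine (h.const_mul_atTop (r := (1 - ε) * 2 / (B - 1))
      (div_pos (by linarith) hB1)).congr fun R => ?_
    unfold visitBound
    ring
  have hqlim : Tendsto (fun R : ℕ => (B - 1) * (1 + ε / 2) / (2 * (R : ℝ)) * (1 + ε / 2)) atTop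
      (𝓝 0) := by
    have h : Tendsto (fun R : ℕ => (1 + ε / 2) * (B - 1) * (1 + ε / 2) / 2 / (R : ℝ)) atTop
      (𝓝 0) := tendsto_const_div_atTop_nhds_zero_nat _
    refine h.congr fun R => ?_
    ring
  obtain ⟨k, hk⟩ := eventually_atTop.1 ((hqlim.eventually (ge_mem_nhds (by linarith : 0 < ε / 2))).and
    ((hvis.eventually_gt_atTop 1).and ((tendsto_log_log_natCast.eventually_ge_atTop 0).and
      (hlog1.eventually_gt_atTop 0))))
  have hnull : ∀ N : ℕ, ∀ᵐ ω ∂P, ¬ ∀ j, j ≠ 0 →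
      localTime X ((2 ^ J) ^ (max i₀ (max k N) + j)) ω <
      (⌈visitBound B ε ((2 ^ J) ^ (max i₀ (max k N) + j))⌉₊ : ℝ≥0∞) := by
    intro N
    rw [ae_iff]
    simp only [not_not]
    refine measure_visit_levels_eq_zero hX hE0 hE1 hE00 hB hi hE hε hε1 hA hJ.le
      (le_max_left _ _) (fun R hR => (hk R ?_).1) (fun R hR => (hk R ?_).2.1)
      (fun R hR => (hk R ?_).2.2)
    all_goals exact ((le_max_left k N).trans (le_max_right _ _)).trans hR
  filter_upwards [ae_all_iff.2 hnull] with ω hω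
  refine frequently_atTop.2 fun N => ?_
  have := hω N
  push Not at this
  obtain ⟨j, hj, h⟩ := this
  have hJ0 : J ≠ 0 := by
    rintro rfl
    rw [pow_zero] at hJ
    nlinarith
  refine ⟨(2 ^ J) ^ (max i₀ (max k N) + j), ?_, le_trans ?_ h⟩
  · have h1 := Nat.lt_pow_self (Nat.one_lt_two_pow hJ0) (n := max i₀ (max k N) + j)
    have h2 := (le_max_right k N).trans (le_max_right i₀ _)
    show N ≤ _
    omega
  · rw [← ENNReal.ofReal_natCast]
    exact ENNReal.ofReal_le_ofReal (Nat.le_ceil _)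

end LowerBound

/-- Every visit to a positive site is followed by an upcrossing or preceded by one of the site
below. -/
lemma localTime_succ_le {Ω : Type*} {X : ℕ → Ω → ℕ} {ω : Ω} (h0 : X 0 ω = 0)
    (hnn : ∀ n, X (n + 1) ω = X n ω + 1 ∨ X (n + 1) ω + 1 = X n ω) (R : ℕ) :
    localTime X (R + 1) ω ≤ upcross X (R + 1) ω + upcross X R ω := by
  have key : ∀ n, (∑ k ∈ Finset.range n, if X k ω = R + 1 then 1 else 0) +
      (if R + 1 ≤ X n ω then 1 else 0) =
      (∑ k ∈ Finset.range n, if X k ω = R + 1 ∧ X (k + 1) ω = R + 1 + 1 then 1 else 0) +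
        ∑ k ∈ Finset.range n, if X k ω = R ∧ X (k + 1) ω = R + 1 then 1 else 0 := by
    intro n
    induction n with
    | zero => simp [h0]
    | succ n ih =>
      simp only [Finset.sum_range_succ]
      have := hnn n
      split_ifs at ih ⊢ <;> omega
  rw [localTime, ENNReal.tsum_eq_iSup_nat]
  refine iSup_le fun n => ?_
  calc (∑ k ∈ Finset.range n, Set.indicator {k | X k ω = R + 1} (fun _ => (1 : ℝ≥0∞)) k)
      = ((∑ k ∈ Finset.range n, if X k ω = R + 1 then 1 else 0 : ℕ) : ℝ≥0∞) := by
        push_cast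
        exact Finset.sum_congr rfl fun k _ => by simp [Set.indicator_apply]
    _ ≤ (((∑ k ∈ Finset.range n, if X k ω = R + 1 ∧ X (k + 1) ω = R + 1 + 1 then 1 else 0) +
        ∑ k ∈ Finset.range n, if X k ω = R ∧ X (k + 1) ω = R + 1 then 1 else 0 : ℕ) : ℝ≥0∞) := by
        rw [← key]
        exact_mod_cast Nat.le_add_right _ _
    _ = (∑ k ∈ Finset.range n, Set.indicator {k | X k ω = R + 1 ∧ X (k + 1) ω = R + 1 + 1}
          (fun _ => (1 : ℝ≥0∞)) k) +
        ∑ k ∈ Finset.range n, Set.indicator {k | X k ω = R ∧ X (k + 1) ω = R + 1}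
          (fun _ => (1 : ℝ≥0∞)) k := by
        push_cast
        congr 1 <;> exact Finset.sum_congr rfl fun k _ => by simp [Set.indicator_apply]
    _ ≤ _ := add_le_add (ENNReal.sum_le_tsum _) (ENNReal.sum_le_tsum _)

/-- The averaging argument for the comparison of local times and upcrossings. -/
lemma limsup_le_limsup_of_le_half_add {a b : ℕ → ℝ≥0∞}
    (h : ∀ᶠ R in atTop, a (R + 1) ≤ 2⁻¹ * (b (R + 1) + b R)) :
    limsup a atTop ≤ limsup b atTop := by
  refine le_of_forall_gt_imp_ge_of_dense fun c hc => ?_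
  rw [← limsup_nat_add a 1]
  have hb := eventually_lt_of_limsup_lt hc
  refine limsup_le_of_le (by isBoundedDefault) ?_
  filter_upwards [h, hb, (tendsto_add_atTop_nat 1).eventually hb] with R h1 h2 h3
  calc a (R + 1) ≤ 2⁻¹ * (b (R + 1) + b R) := h1
    _ ≤ 2⁻¹ * (c + c) := by gcongr
    _ = c := by rw [← two_mul, ← mul_assoc, ENNReal.inv_mul_cancel (by simp) (by simp), one_mul]

end NNRW

open NNRW
/-- for `p_R = B/(4R)` (truncation convention), `B > 1`, a.s.
`limsup (B-1) ξ(R,∞)/(2 R log log R) = 1` and `limsup (B-1) ξ(R,∞,↑)/(R log log R) = 1`. -/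
theorem stmt15 (B : ℝ) (hB : 1 < B) (p : ℕ → ℝ)
    (hp : ∀ i, 1 ≤ i → 0 ≤ p i ∧ p i < 1 / 2)
    (htr : IsTruncation (fun i : ℕ => B / (4 * (i : ℝ))) p)
    (Ω : Type) [MeasurableSpace Ω] (P : Measure Ω) [IsProbabilityMeasure P]
    (X : ℕ → Ω → ℕ) (hX : IsNNWalk P X p 0) :
    ∀ᵐ ω ∂P,
      Filter.limsup (fun R : ℕ =>
          ENNReal.ofReal (B - 1) * localTime X R ω /
            (2 * (R : ℝ≥0∞) * ENNReal.ofReal (Real.log (Real.log (R : ℝ))))) atTop = 1 ∧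
      Filter.limsup (fun R : ℕ =>
          ENNReal.ofReal (B - 1) * upcross X R ω /
            ((R : ℝ≥0∞) * ENNReal.ofReal (Real.log (Real.log (R : ℝ))))) atTop = 1 := by
  have hB1 : 0 < B - 1 := by linarith
  obtain ⟨i₀, hi₀, hlt, -, hpe, hpq⟩ := htr
  have hi₀' : (0 : ℝ) < i₀ := by exact_mod_cast hi₀
  have hi : B < 2 * i₀ := by
    simp only at hlt
    rw [div_lt_iff₀ (by positivity)] at hlt
    linarith
  have hE00 : E p 0 = 1 := by simp [E]
  have hE0 : ∀ i, 1 / 2 ≤ E p i := by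
    intro i
    unfold E
    split_ifs with h
    · norm_num
    · linarith [(hp i (by omega)).1]
  have hE1 : ∀ i, E p i ≤ 1 := by
    intro i
    unfold E
    split_ifs with h
    · exact le_rfl
    · linarith [(hp i (by omega)).2]
  have hE : ∀ i, i₀ ≤ i → E p i = 1 / 2 + B / (4 * (i : ℝ)) := by
    intro i h
    unfold E
    rw [if_neg (by omega)]
    rcases h.eq_or_lt with rfl | h
    · rw [hpe _ hi₀ le_rfl]
    · rw [hpq i h]
  have hE0' : ∀ i, 0 < E p i := fun i => lt_of_lt_of_le (by norm_num) (hE0 i)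
  obtain ⟨u, -, hu, hu0⟩ := exists_seq_strictAnti_tendsto' (zero_lt_one (α := ℝ))
  have hup := ae_all_iff.2 fun n =>
    ae_eventually_upcross_le hX hE0' hE1 hB hi hE (hu n).1 (hu n).2.le
  have hlow := ae_all_iff.2 fun n =>
    ae_frequently_le_localTime hX hE0 hE1 hE00 hB hi hE (hu n).1 (hu n).2
  have hpos : ∀ᶠ R : ℕ in atTop, 0 < Real.log (Real.log R) ∧ 0 < Real.log R ∧ 0 < (R : ℝ) :=
    (tendsto_log_log_natCast.eventually_gt_atTop 0).and
      (((Real.tendsto_log_atTop.comp tendsto_natCast_atTop_atTop).eventually_gt_atTop 0).and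
        (tendsto_natCast_atTop_atTop.eventually_gt_atTop 0))
  filter_upwards [hup, hlow, ae_nearest_neighbour hX (fun i => (hE0' i).le) hE1 hE00]
    with ω hωu hωl hnn
  set c : ℕ → ℝ≥0∞ := fun R => (R : ℝ≥0∞) * ENNReal.ofReal (Real.log (Real.log (R : ℝ)))
    with hc
  set a : ℕ → ℝ≥0∞ := fun R => ENNReal.ofReal (B - 1) * localTime X R ω /
    (2 * (R : ℝ≥0∞) * ENNReal.ofReal (Real.log (Real.log (R : ℝ)))) with ha
  set b : ℕ → ℝ≥0∞ := fun R => ENNReal.ofReal (B - 1) * upcross X R ω / c R with hb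
  have hcR : ∀ R : ℕ, c R = ENNReal.ofReal (R * Real.log (Real.log R)) := fun R => by
    rw [ENNReal.ofReal_mul (by positivity), ENNReal.ofReal_natCast]
  have hac : ∀ R, a R = 2⁻¹ * (ENNReal.ofReal (B - 1) * localTime X R ω / c R) := fun R => by
    simp only [ha, hc]
    rw [mul_assoc 2, div_eq_mul_inv, ENNReal.mul_inv (by simp) (by simp), div_eq_mul_inv]
    ring
  have hle : limsup a atTop ≤ limsup b atTop := by
    refine limsup_le_limsup_of_le_half_add ?_
    filter_upwards [hpos] with R ⟨h1, h2, h3⟩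
    rw [hac]
    gcongr
    have hcc : c R ≤ c (R + 1) := by
      rw [hcR, hcR]
      apply ENNReal.ofReal_le_ofReal
      have h4 : (R : ℝ) ≤ ((R + 1 : ℕ) : ℝ) := by push_cast; linarith
      have h5 := Real.log_le_log h3 h4
      have h6 := Real.log_le_log h2 h5
      gcongr
    calc ENNReal.ofReal (B - 1) * localTime X (R + 1) ω / c (R + 1)
        ≤ ENNReal.ofReal (B - 1) * (upcross X (R + 1) ω + upcross X R ω) / c (R + 1) := by
          gcongr
          exact localTime_succ_le (hX.1 ω) hnn R
      _ = b (R + 1) + ENNReal.ofReal (B - 1) * upcross X R ω / c (R + 1) := by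
          rw [mul_add, ENNReal.add_div]
      _ ≤ b (R + 1) + b R := by
          simp only [hb]
          gcongr
  have hb1 : limsup b atTop ≤ 1 := by
    have hlim : Tendsto (fun n => ENNReal.ofReal (1 + u n)) atTop (𝓝 1) := by
      simpa using ENNReal.tendsto_ofReal (hu0.const_add 1)
    refine ge_of_tendsto' hlim fun n => limsup_le_of_le (by isBoundedDefault) ?_
    filter_upwards [hωu n, hpos] with R hR ⟨h1, _, h3⟩
    refine ENNReal.div_le_of_le_mul ?_
    rw [hcR, ← ENNReal.ofReal_mul (by linarith [(hu n).1])]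
    refine (mul_le_mul_right hR _).trans (le_of_eq ?_)
    rw [← ENNReal.ofReal_mul hB1.le]
    congr 1
    field_simp
  have ha1 : 1 ≤ limsup a atTop := by
    have hlim : Tendsto (fun n => ENNReal.ofReal (1 - u n)) atTop (𝓝 1) := by
      simpa using ENNReal.tendsto_ofReal (hu0.const_sub 1)
    refine le_of_tendsto' hlim fun n => le_limsup_of_frequently_le ?_ (by isBoundedDefault)
    refine ((hωl n).and_eventually hpos).mono ?_
    rintro R ⟨hR, h1, _, h3⟩
    have hc0 : (2 * (R : ℝ≥0∞) * ENNReal.ofReal (Real.log (Real.log (R : ℝ)))) =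
        ENNReal.ofReal (2 * R * Real.log (Real.log R)) := by
      rw [ENNReal.ofReal_mul (by positivity), ENNReal.ofReal_mul (by norm_num)]
      simp
    simp only [ha]
    have hne : ENNReal.ofReal (2 * R * Real.log (Real.log R)) ≠ 0 :=
      (ENNReal.ofReal_pos.2 (by positivity)).ne'
    rw [hc0, ENNReal.le_div_iff_mul_le (Or.inl hne) (Or.inl ENNReal.ofReal_ne_top),
      ← ENNReal.ofReal_mul (by linarith [(hu n).2])]
    refine le_trans (le_of_eq ?_) (mul_le_mul_right hR _)
    rw [← ENNReal.ofReal_mul hB1.le]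
    congr 1
    unfold visitBound
    field_simp
  exact ⟨le_antisymm (hle.trans hb1) ha1, le_antisymm hb1 (ha1.trans hle)⟩
end
end
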